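/- Let G and H be ancestral graphs on vertex set [p], and let 𝓘 be a multiset of intervention targets (subsets of [p]) that doubly-intervenes on no selection adjacent node of G and no selection adjacent node of H. Then the following are equivalent: (1) G and H are 𝓘-Markov equivalent; (2) the unique maximal extensions \bar{G} and \bar{H} are 𝓘-Markov equivalent; (3) \bar{G} and \bar{H} are Markov equivalent and the interventional graphs \bar{G}^𝓘 and \bar{H}^𝓘 have the same 𝓘-colliders with order. -/

import Mathlib

/-
Common formalization infrastructure for loopless mixed graphs (LMGs),
m-separation, Markov equivalence, interventional graphs, ribbons,
ancestral graphs, colliders with order, and the head/tail factorization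
machinery of acyclic directed mixed graphs (ADMGs), following
"Distributional Invariances and Interventional Markov Equivalence
for Mixed Graph Models" (Solus).
-/

open Relation

/-- An endpoint mark of an edge in a mixed graph: either a tail or an arrowhead. -/
inductive Mark : Type
  | tail : Mark
  | arrow : Mark
  deriving DecidableEq

/-- A mixed graph on a vertex type `V`: `edge a b m₁ m₂` means there is an edge
between `a` and `b` carrying mark `m₁` at `a` and mark `m₂` at `b`.
Undirected edges are `(tail, tail)`, directed `a → b` is `(tail, arrow)`,
and bidirected is `(arrow, arrow)`. -/
structure MixedGraph (V : Type) : Type where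
  edge : V → V → Mark → Mark → Prop

namespace MixedGraph

variable {V : Type}

/-- A loopless mixed graph: edges are symmetric (with endpoint marks swapped) and no loops. -/
def IsLMG (G : MixedGraph V) : Prop :=
  (∀ a b m₁ m₂, G.edge a b m₁ m₂ → G.edge b a m₂ m₁) ∧ ∀ a m₁ m₂, ¬ G.edge a a m₁ m₂

/-- Two vertices are adjacent if there is some edge between them. -/
def adj (G : MixedGraph V) (a b : V) : Prop := ∃ m₁ m₂, G.edge a b m₁ m₂

/-- A simple mixed graph: at most one edge between any two nodes. -/
def Simple (G : MixedGraph V) : Prop :=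
  ∀ a b m₁ m₂ n₁ n₂, G.edge a b m₁ m₂ → G.edge a b n₁ n₂ → m₁ = n₁ ∧ m₂ = n₂

/-- A directed edge `a → b`. -/
def dirEdge (G : MixedGraph V) (a b : V) : Prop := G.edge a b Mark.tail Mark.arrow

/-- A bidirected edge `a ↔ b`. -/
def bidirEdge (G : MixedGraph V) (a b : V) : Prop := G.edge a b Mark.arrow Mark.arrow

/-- An undirected edge `a − b`. -/
def undirEdge (G : MixedGraph V) (a b : V) : Prop := G.edge a b Mark.tail Mark.tail

/-- `a` is an ancestor of `b` (reflexively: there is a directed path, possibly trivial). -/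
def ancestor (G : MixedGraph V) (a b : V) : Prop := ReflTransGen G.dirEdge a b

/-- A node is selection adjacent when it is an endpoint of an undirected edge. -/
def selectionAdjacent (G : MixedGraph V) (a : V) : Prop := ∃ b, G.undirEdge a b ∨ G.undirEdge b a

/-- An ancestral graph: an LMG with no directed cycles, no bidirected edge with a
(nontrivial) directed path between its endpoints, and no arrowhead pointing into a
selection adjacent node. -/
def IsAncestral (G : MixedGraph V) : Prop :=
  G.IsLMG ∧ (∀ a, ¬ TransGen G.dirEdge a a) ∧
    (∀ a b, G.bidirEdge a b → ¬ TransGen G.dirEdge a b ∧ ¬ TransGen G.dirEdge b a) ∧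
    ∀ a, G.selectionAdjacent a → ∀ b m, ¬ G.edge b a m Mark.arrow

/-- An acyclic directed mixed graph: only directed and bidirected edges, no directed cycles. -/
def IsADMG (G : MixedGraph V) : Prop :=
  G.IsLMG ∧ (∀ a b m₁ m₂, G.edge a b m₁ m₂ → ¬ (m₁ = Mark.tail ∧ m₂ = Mark.tail)) ∧
    ∀ a, ¬ TransGen G.dirEdge a a

/-- A directed acyclic graph: only directed edges, and no directed cycles. -/
def IsDAG (G : MixedGraph V) : Prop :=
  G.IsLMG ∧
    (∀ a b m₁ m₂, G.edge a b m₁ m₂ →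
      (m₁ = Mark.tail ∧ m₂ = Mark.arrow) ∨ (m₁ = Mark.arrow ∧ m₂ = Mark.tail)) ∧
    ∀ a, ¬ TransGen G.dirEdge a a

/-- A directed ancestral graph: an ancestral graph with no undirected edges. -/
def IsDirectedAncestral (G : MixedGraph V) : Prop := G.IsAncestral ∧ ∀ a b, ¬ G.undirEdge a b

/-- A walk in a mixed graph `G`, recording at each step the pair of endpoint marks used. -/
structure MWalk (G : MixedGraph V) : Type where
  len : ℕ
  vtx : ℕ → V
  mk₁ : ℕ → Mark
  mk₂ : ℕ → Mark
  isEdge : ∀ i, i < len → G.edge (vtx i) (vtx (i + 1)) (mk₁ i) (mk₂ i)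

namespace MWalk

variable {G : MixedGraph V}

/-- The interior vertex at position `i` is a collider on the walk. -/
def colliderAt (w : MWalk G) (i : ℕ) : Prop :=
  0 < i ∧ i < w.len ∧ w.mk₂ (i - 1) = Mark.arrow ∧ w.mk₁ i = Mark.arrow

/-- The walk is a path: all of its vertices are pairwise distinct. -/
def IsPath (w : MWalk G) : Prop :=
  ∀ i j, i ≤ w.len → j ≤ w.len → w.vtx i = w.vtx j → i = j

/-- The walk is m-connecting given `C`: all colliders are in `C` or ancestors of `C`,
all non-collider vertices are outside of `C`. -/
def mConnecting (w : MWalk G) (C : Set V) : Prop :=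
  (∀ i, w.colliderAt i → ∃ c ∈ C, G.ancestor (w.vtx i) c) ∧
    ∀ i, i ≤ w.len → ¬ w.colliderAt i → w.vtx i ∉ C

end MWalk

/-- There is an m-connecting path between `a` and `b` given `C`. -/
def mConnected (G : MixedGraph V) (a b : V) (C : Set V) : Prop :=
  ∃ w : MWalk G, w.IsPath ∧ w.vtx 0 = a ∧ w.vtx w.len = b ∧ w.mConnecting C

/-- `C` m-separates `A` and `B` in `G`. -/
def mSep (G : MixedGraph V) (A B C : Set V) : Prop := ∀ a ∈ A, ∀ b ∈ B, ¬ G.mConnected a b C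

/-- The (formal) independence model `J(G)`: triples `⟨A,B∣C⟩` with `A,B` disjoint
and m-separated given `C`. -/
def indep (G : MixedGraph V) (A B C : Set V) : Prop := Disjoint A B ∧ G.mSep A B C

/-- Markov equivalence: equal independence models. -/
def MarkovEquiv (G H : MixedGraph V) : Prop := ∀ A B C : Set V, G.indep A B C ↔ H.indep A B C

/-- The result of adding a single edge (with marks `m₁, m₂`) between `a` and `b`. -/
def addEdge (G : MixedGraph V) (a b : V) (m₁ m₂ : Mark) : MixedGraph V where
  edge x y n₁ n₂ := G.edge x y n₁ n₂ ∨ (x = a ∧ y = b ∧ n₁ = m₁ ∧ n₂ = m₂) ∨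
    (x = b ∧ y = a ∧ n₁ = m₂ ∧ n₂ = m₁)

/-- A mixed graph is maximal if adding any edge between nonadjacent vertices changes
its independence model. -/
def IsMaximal (G : MixedGraph V) : Prop :=
  ∀ a b, a ≠ b → ¬ G.adj a b → ∀ m₁ m₂, ¬ MarkovEquiv (G.addEdge a b m₁ m₂) G

/-- `G` is an (edge-)subgraph of `K` on the same vertex set. -/
def Subgraph (G K : MixedGraph V) : Prop := ∀ a b m₁ m₂, G.edge a b m₁ m₂ → K.edge a b m₁ m₂

/-- `K` is the maximal ancestral graph extension of the ancestral graph `G`: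
a Markov equivalent maximal ancestral supergraph. -/
def IsMAGExtension (G K : MixedGraph V) : Prop :=
  Subgraph G K ∧ K.IsAncestral ∧ MarkovEquiv G K ∧ K.IsMaximal

/-- `G` contains a ribbon: a collider path `⟨i,j,k⟩` with no endpoint-identical edge
between `i` and `k` such that `j` or a descendant of `j` is selection adjacent
or lies on a directed cycle. -/
def hasRibbon (G : MixedGraph V) : Prop :=
  ∃ i j k m₁ m₂, i ≠ k ∧ G.edge i j m₁ Mark.arrow ∧ G.edge j k Mark.arrow m₂ ∧
    ¬ G.edge i k m₁ m₂ ∧ ∃ d, G.ancestor j d ∧ (G.selectionAdjacent d ∨ TransGen G.dirEdge d d)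

/-- Ribbonless graph. -/
def Ribbonless (G : MixedGraph V) : Prop := ¬ G.hasRibbon

/-- `K` is the maximal ribbonless extension of the ribbonless graph `G`. -/
def IsRGExtension (G K : MixedGraph V) : Prop :=
  Subgraph G K ∧ K.Ribbonless ∧ MarkovEquiv G K ∧ K.IsMaximal

/-- `⟨i,j,k⟩` is a collider path (both edges have an arrowhead at `j`). -/
def isCollider (G : MixedGraph V) (i j k : V) : Prop :=
  ∃ m₁ m₂, G.edge i j m₁ Mark.arrow ∧ G.edge j k Mark.arrow m₂

/-- A v-structure: a collider whose endpoints are nonadjacent. -/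
def isVStructure (G : MixedGraph V) (i j k : V) : Prop := G.isCollider i j k ∧ ¬ G.adj i k

/-- There is a discriminating path `⟨w 0, …, w m, w (m+1), w (m+2)⟩ = ⟨v₀,…,v_m,b,c⟩`
for the triple `⟨i,j,k⟩`, all of whose intermediate triples satisfy `P`:
`v₀` and `c` are nonadjacent, `v₁,…,v_m` are parents of `c`, and the triples
`⟨v₀,v₁,v₂⟩, …, ⟨v_{m-1},v_m,b⟩` satisfy `P`. -/
def discPathFor (G : MixedGraph V) (P : V → V → V → Prop) (i j k : V) : Prop :=
  ∃ (m : ℕ) (w : ℕ → V), 1 ≤ m ∧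
    ((w m = i ∧ w (m + 1) = j ∧ w (m + 2) = k) ∨ (w m = k ∧ w (m + 1) = j ∧ w (m + 2) = i)) ∧
    ¬ G.adj (w 0) (w (m + 2)) ∧
    (∀ l, 1 ≤ l → l ≤ m → G.dirEdge (w l) (w (m + 2))) ∧
    (∀ l l', l ≤ m + 2 → l' ≤ m + 2 → w l = w l' → l = l') ∧
    ∀ l, l + 2 ≤ m + 1 → P (w l) (w (l + 1)) (w (l + 2))

/-- `⟨i,j,k⟩` is a collider with order at most `t`. Order `0` colliders are
v-structures; a collider has order at most `t+1` if it has order at most `t` or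
lies at the end of a discriminating path all of whose intermediate triples are
colliders of order at most `t`. -/
def colliderOrderLE (G : MixedGraph V) : ℕ → V → V → V → Prop
  | 0, i, j, k => G.isCollider i j k ∧ ¬ G.adj i k
  | t + 1, i, j, k =>
      colliderOrderLE G t i j k ∨
        (G.isCollider i j k ∧ G.discPathFor (colliderOrderLE G t) i j k)

/-- `⟨i,j,k⟩` is a collider with order (for some order). -/
def hasColliderWithOrder (G : MixedGraph V) (i j k : V) : Prop := ∃ t, G.colliderOrderLE t i j k

/-- `⟨i,j,k⟩` is a collider with order exactly `t`. -/
def colliderOrderEq (G : MixedGraph V) (t : ℕ) (i j k : V) : Prop :=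
  G.colliderOrderLE t i j k ∧ ∀ s < t, ¬ G.colliderOrderLE s i j k

/-- `a` is anterior to `b`: there is a path from `a` to `b` consisting of undirected
edges followed by a directed path toward `b`. -/
def anteriorTo (G : MixedGraph V) (a b : V) : Prop :=
  ∃ c, ReflTransGen G.undirEdge a c ∧ ReflTransGen G.dirEdge c b

/-- The closure of the set of selection adjacent nodes under the operation of
consecutively removing arrowheads pointing into such nodes (`i → j − k` becomes
`i − j − k`, creating the new selection adjacent node `i`). -/
inductive selClosure (G : MixedGraph V) : V → Prop
  | base (a b : V) : G.undirEdge a b → selClosure G a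
  | base' (a b : V) : G.undirEdge b a → selClosure G a
  | step (a b : V) : G.dirEdge a b → selClosure G b → selClosure G a

/-- The anterior graph `G*` of `G`: consecutively remove all arrowheads pointing into
nodes adjacent to an undirected edge. -/
def anteriorGraph (G : MixedGraph V) : MixedGraph V where
  edge a b m₁ m₂ := ∃ n₁ n₂, G.edge a b n₁ n₂ ∧
    ((selClosure G a ∧ m₁ = Mark.tail) ∨ (¬ selClosure G a ∧ m₁ = n₁)) ∧
    ((selClosure G b ∧ m₂ = Mark.tail) ∨ (¬ selClosure G b ∧ m₂ = n₂))

/-- The set of parents of `i`. -/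
def parentsSet (G : MixedGraph V) (i : V) : Set V := {a | G.dirEdge a i}

/-- The set of spouses of `i`. -/
def spousesSet (G : MixedGraph V) (i : V) : Set V := {a | G.bidirEdge i a}

/-- The set of ancestors of a set `S` (including `S` itself). -/
def ancSet (G : MixedGraph V) (S : Set V) : Set V := {a | ∃ s ∈ S, G.ancestor a s}

/-- A set is ancestrally closed when it equals its set of ancestors. -/
def AncestrallyClosed (G : MixedGraph V) (A : Set V) : Prop := A = G.ancSet A

/-- The district of `i` in the induced subgraph on `A`: the connected component of `i`
under bidirected edges within `A`. -/
def districtIn (G : MixedGraph V) (A : Set V) (i : V) : Set V :=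
  {j | j ∈ A ∧ ReflTransGen (fun x y => x ∈ A ∧ y ∈ A ∧ G.bidirEdge x y) i j}

/-- Two vertices lie in a common district of `G`. -/
def sameDistrict (G : MixedGraph V) (a b : V) : Prop :=
  ∃ d, a ∈ G.districtIn Set.univ d ∧ b ∈ G.districtIn Set.univ d

/-- The barren subset of `A`: those `x ∈ A` with no proper descendants inside `A`. -/
def barren (G : MixedGraph V) (A : Set V) : Set V :=
  {x | x ∈ A ∧ ∀ y ∈ A, G.ancestor x y → y = x}

/-- The head-extraction step `Φ_G(A)`. -/
def headsStep (G : MixedGraph V) (A : Set V) : Set (Set V) :=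
  {H | H.Nonempty ∧ H = ⋂ i ∈ H, G.barren (G.ancSet (G.districtIn A i))}

/-- The residual step `Ψ_G(A)`. -/
def psi (G : MixedGraph V) (A : Set V) : Set V := A \ ⋃ H ∈ G.headsStep A, H

/-- The partition `[A]_G` of `A` into heads. -/
def heads (G : MixedGraph V) (A : Set V) : Set (Set V) :=
  {H | ∃ n : ℕ, H ∈ G.headsStep ((G.psi)^[n] A)}

/-- `dis_{an(H)}(H)`: the union of the districts of the elements of `H` in the induced
subgraph on the ancestors of `H`. -/
def headDistrict (G : MixedGraph V) (H : Set V) : Set V :=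
  ⋃ i ∈ H, G.districtIn (G.ancSet H) i

/-- The tail of a head `H`: `(dis_{an(H)}(H) \ H) ∪ pa_G(dis_{an(H)}(H))`. -/
def tailOf (G : MixedGraph V) (H : Set V) : Set V :=
  (G.headDistrict H \ H) ∪ {a | ∃ s ∈ G.headDistrict H, G.dirEdge a s}

end MixedGraph

/-- The index set `W_𝓘` of intervention nodes: (occurrences of) nonempty targets. -/
abbrev InterventionIndex {V ι : Type} (targets : ι → Set V) : Type :=
  {k : ι // (targets k).Nonempty}

/-- The interventional graph `G^𝓘`: add a source node `ω_I` for each nonempty target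
`I ∈ 𝓘` together with the edges `ω_I → i` for all `i ∈ I`. -/
def interventionGraph {V ι : Type} (G : MixedGraph V) (targets : ι → Set V) :
    MixedGraph (V ⊕ InterventionIndex targets) where
  edge a b m₁ m₂ :=
    match a, b with
    | Sum.inl a, Sum.inl b => G.edge a b m₁ m₂
    | Sum.inr k, Sum.inl b => b ∈ targets k.1 ∧ m₁ = Mark.tail ∧ m₂ = Mark.arrow
    | Sum.inl a, Sum.inr k => a ∈ targets k.1 ∧ m₁ = Mark.arrow ∧ m₂ = Mark.tail
    | Sum.inr _, Sum.inr _ => False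

/-- The multiset of targets doubly-intervenes on `i`: two distinct elements of the
multiset both contain `i`. -/
def doublyIntervenes {V ι : Type} (targets : ι → Set V) (i : V) : Prop :=
  ∃ k k' : ι, k ≠ k' ∧ i ∈ targets k ∧ i ∈ targets k'

/-- `𝓘`-Markov equivalence: the interventional graphs have the same independence models. -/
def IMarkovEquiv {V ι : Type} (G H : MixedGraph V) (targets : ι → Set V) : Prop :=
  MixedGraph.MarkovEquiv (interventionGraph G targets) (interventionGraph H targets)

/-- An `𝓘`-collider with order: a collider with order in `G^𝓘` that is not a collider
with order in `G`. -/
def IColliderWithOrder {V ι : Type} (G : MixedGraph V) (targets : ι → Set V)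
    (i j k : V ⊕ InterventionIndex targets) : Prop :=
  (interventionGraph G targets).hasColliderWithOrder i j k ∧
    ¬ ∃ i' j' k' : V, i = Sum.inl i' ∧ j = Sum.inl j' ∧ k = Sum.inl k' ∧
      G.hasColliderWithOrder i' j' k'

/-- An `𝓘`-v-structure: a v-structure of `G^𝓘` with an endpoint in `W_𝓘`. -/
def IVStructure {V ι : Type} (G : MixedGraph V) (targets : ι → Set V)
    (i j k : V ⊕ InterventionIndex targets) : Prop :=
  (interventionGraph G targets).isVStructure i j k ∧
    ((∃ κ, i = Sum.inr κ) ∨ (∃ κ, k = Sum.inr κ))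

/-- The induced subgraph of a graph on `[p] ∪ W_𝓘` on the observed vertex set `[p]`. -/
def observedPart {V ι : Type} {targets : ι → Set V}
    (K : MixedGraph (V ⊕ InterventionIndex targets)) : MixedGraph V where
  edge a b m₁ m₂ := K.edge (Sum.inl a) (Sum.inl b) m₁ m₂

namespace MixedGraph

variable {V : Type} {G H K : MixedGraph V}

/-! ### Basic facts about ancestral graphs -/

section Ancestral

variable {a b c : V} {m n m' n' : Mark}

lemma IsAncestral.symm (hG : G.IsAncestral) (h : G.edge a b m n) : G.edge b a n m :=
  hG.1.1 _ _ _ _ h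

lemma IsAncestral.ne (hG : G.IsAncestral) (h : G.edge a b m n) : a ≠ b := by
  rintro rfl
  exact hG.1.2 _ _ _ h

lemma IsAncestral.adj_symm (hG : G.IsAncestral) (h : G.adj a b) : G.adj b a := by
  obtain ⟨m, n, h⟩ := h
  exact ⟨n, m, hG.symm h⟩

lemma IsAncestral.not_ancestor_of_arrow (hG : G.IsAncestral) (h : G.edge a b m .arrow) :
    ¬ G.ancestor b a := by
  intro hba
  rcases reflTransGen_iff_eq_or_transGen.1 hba with rfl | hba
  · exact hG.1.2 _ _ _ h
  · cases m
    · exact hG.2.1 a (.head h hba)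
    · exact (hG.2.2.1 a b h).2 hba

lemma IsAncestral.eq_arrow_of_tail (hG : G.IsAncestral) (h : G.edge a b m .arrow)
    (h' : G.edge b c .tail n) : n = .arrow := by
  cases n
  · exact (hG.2.2.2 b ⟨c, .inl h'⟩ a m h).elim
  · rfl

lemma IsAncestral.dirEdge_of_tail (hG : G.IsAncestral) (h : G.edge a b m .arrow)
    (h' : G.edge b c .tail n) : G.dirEdge b c := by
  obtain rfl := hG.eq_arrow_of_tail h h'
  exact h'

lemma IsAncestral.simple (hG : G.IsAncestral) : G.Simple := by
  have key : ∀ {a b m₁ m₂ n₁ n₂}, G.edge a b m₁ m₂ → G.edge a b n₁ n₂ → m₂ = n₂ := by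
    intro a b m₁ m₂ n₁ n₂ h h'
    have aux : ∀ {m₁ n₁}, G.edge a b m₁ .tail → G.edge a b n₁ .arrow → False := by
      intro m₁ n₁ h h'
      have := hG.dirEdge_of_tail h' (hG.symm h)
      exact hG.not_ancestor_of_arrow h' (.single this)
    cases m₂ <;> cases n₂
    · rfl
    · exact (aux h h').elim
    · exact (aux h' h).elim
    · rfl
  exact fun a b m₁ m₂ n₁ n₂ h h' => ⟨key (hG.symm h) (hG.symm h'), key h h'⟩

lemma exists_arrow_of_transGen (h : TransGen G.dirEdge a b) :
    ∃ c, G.edge c b .tail .arrow := by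
  obtain ⟨c, -, hc⟩ := TransGen.tail'_iff.1 h
  exact ⟨c, hc⟩

/-- Adjacent vertices one of which is an ancestor of the other are joined by a directed edge. -/
lemma IsAncestral.dirEdge_of_transGen (hG : G.IsAncestral) (h : G.edge a b m n)
    (hab : TransGen G.dirEdge a b) : m = .tail ∧ n = .arrow := by
  obtain ⟨c, hc⟩ := exists_arrow_of_transGen hab
  have hm : m = .tail := by
    cases m
    · rfl
    · exact (hG.not_ancestor_of_arrow (hG.symm h) hab.to_reflTransGen).elim
  refine ⟨hm, ?_⟩
  subst hm
  cases n
  · exact absurd (hG.eq_arrow_of_tail hc (hG.symm h)) (by simp)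
  · rfl

/-- If `a *→ b` and `b` is a proper ancestor of `c`, any edge between `a` and `c` has an
arrowhead at `c`. -/
lemma IsAncestral.eq_arrow_of_transGen (hG : G.IsAncestral) (h : G.edge a b m .arrow)
    (hbc : TransGen G.dirEdge b c) (h' : G.edge a c m' n') : n' = .arrow := by
  obtain ⟨e, he⟩ := exists_arrow_of_transGen hbc
  cases n'
  · have := hG.dirEdge_of_tail he (hG.symm h')
    exact (hG.not_ancestor_of_arrow h (hbc.to_reflTransGen.tail this)).elim
  · rfl

lemma IsAncestral.isCollider_symm (hG : G.IsAncestral) (h : G.isCollider a b c) :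
    G.isCollider c b a := by
  obtain ⟨m, n, h, h'⟩ := h
  exact ⟨n, m, hG.symm h', hG.symm h⟩

lemma IsAncestral.edge_arrow_of_isCollider_right (hG : G.IsAncestral) (h : G.isCollider a b c)
    (h' : G.edge b c m n) : m = .arrow := by
  obtain ⟨_, _, -, h⟩ := h
  exact (hG.simple _ _ _ _ _ _ h' h).1

/-- The relation of being joined by an edge with a tail at the first vertex. -/
def tailEdge (G : MixedGraph V) (a b : V) : Prop := ∃ m, G.edge a b .tail m

lemma IsAncestral.transGen_dirEdge_of_tailEdge (hG : G.IsAncestral) (h : G.edge c a m .arrow)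
    (hab : TransGen G.tailEdge a b) : TransGen G.dirEdge a b := by
  induction hab using TransGen.head_induction_on generalizing c m with
  | single hab =>
    obtain ⟨n, hab⟩ := hab
    exact .single (hG.dirEdge_of_tail h hab)
  | head hab _ ih =>
    obtain ⟨n, hab⟩ := hab
    have := hG.dirEdge_of_tail h hab
    exact .head this (ih this)

lemma IsAncestral.ancestor_of_tailEdge (hG : G.IsAncestral) (h : G.edge c a m .arrow)
    (hab : ReflTransGen G.tailEdge a b) : G.ancestor a b := by
  rcases reflTransGen_iff_eq_or_transGen.1 hab with rfl | hab
  · exact .refl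
  · exact (hG.transGen_dirEdge_of_tailEdge h hab).to_reflTransGen

lemma tailEdge_of_ancestor (h : G.ancestor a b) : ReflTransGen G.tailEdge a b :=
  ReflTransGen.mono (p := G.tailEdge) (fun _ _ h => ⟨_, h⟩) _ _ h

end Ancestral

/-! ### Connecting walks -/

/-- The condition for a walk to pass through `v`, entering it with mark `m` and leaving it with
mark `n` (`none` at an end of the walk): colliders lie in `S`, other vertices outside `C`. -/
def Passes (C S : Set V) (v : V) (m n : Option Mark) : Prop :=
  (m = some .arrow ∧ n = some .arrow ∧ v ∈ S) ∨ (¬ (m = some .arrow ∧ n = some .arrow) ∧ v ∉ C)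

/-- The weight `d v` if `v` is a collider, and zero otherwise. -/
def colliderCost (d : V → ℕ) (v : V) (m n : Option Mark) : ℕ :=
  if m = some .arrow ∧ n = some .arrow then d v else 0

/-- `G.Reaches C S d x v m n s`: there is a walk with `n` edges from `x` to `v`, with mark `m` at
`v`, whose vertices before `v` satisfy `Passes C S` and whose colliders have total weight `s`. -/
inductive Reaches (G : MixedGraph V) (C S : Set V) (d : V → ℕ) (x : V) :
    V → Option Mark → ℕ → ℕ → Prop
  | nil : Reaches G C S d x x none 0 0
  | step {v w : V} {m : Option Mark} {n s : ℕ} {m₁ m₂ : Mark} : Reaches G C S d x v m n s →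
      G.edge v w m₁ m₂ → Passes C S v m (some m₁) →
      Reaches G C S d x w (some m₂) (n + 1) (s + colliderCost d v m (some m₁))

section Reaches

variable {C S : Set V} {d : V → ℕ} {x y v w : V} {m m' : Option Mark} {n n' s s' : ℕ}

lemma passes_of_notMem (h : v ∉ C) (hm : ¬ (m = some .arrow ∧ m' = some .arrow)) :
    Passes C S v m m' := .inr ⟨hm, h⟩

lemma Passes.symm (h : Passes C S v m m') : Passes C S v m' m := by
  unfold Passes at *
  tauto

lemma Passes.notMem (h : Passes C S v m m') (hm : ¬ (m = some .arrow ∧ m' = some .arrow)) :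
    v ∉ C := by
  unfold Passes at h
  tauto

lemma Passes.mem (h : Passes C S v (some .arrow) (some .arrow)) : v ∈ S := by
  simpa [Passes] using h

lemma Passes.notMem_none (h : Passes C S v none m') : v ∉ C := h.notMem (by simp)

lemma passes_none (h : v ∉ C) : Passes C S v none m' := passes_of_notMem h (by simp)

lemma passes_none_right (h : v ∉ C) : Passes C S v m none := passes_of_notMem h (by simp)

lemma passes_tail (h : v ∉ C) : Passes C S v m (some .tail) := passes_of_notMem h (by simp)

lemma colliderCost_symm : colliderCost d v m m' = colliderCost d v m' m := by
  simp [colliderCost, and_comm]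

lemma Reaches.exists_arrow (h : G.Reaches C S d x v (some .arrow) n s) :
    ∃ a m, G.edge a v m .arrow := by
  cases h with
  | step _ he _ => exact ⟨_, _, he⟩

/-- Joining a walk from `x` to `v` with the reverse of a walk from `y` to `v`. -/
lemma Reaches.join (hG : G.IsAncestral) (h : G.Reaches C S d x v m n s)
    (h' : G.Reaches C S d y v m' n' s') (hv : Passes C S v m m') :
    ∃ k, G.Reaches C S d x y k (n + n') (s + s' + colliderCost d v m m') := by
  induction h' generalizing m n s with
  | nil => exact ⟨m, by simpa [colliderCost] using h⟩
  | @step u v k n' s' m₁ m₂ hu he hp ih =>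
    obtain ⟨k', hk'⟩ := ih (h.step (hG.symm he) hv) hp.symm
    refine ⟨k', ?_⟩
    rw [colliderCost_symm (v := u)] at hk'
    convert hk' using 1 <;> ring

/-- Every vertex which a connecting walk leaves backwards through a tail is anterior to
a collider or to the origin of the walk. -/
lemma Reaches.anterior (hG : G.IsAncestral) (h : G.Reaches C S d x v (some .tail) n s) :
    (∃ u ∈ S, ReflTransGen G.tailEdge v u) ∨ TransGen G.tailEdge v x := by
  suffices ∀ m, G.Reaches C S d x v m n s → m = some .tail →
      (∃ u ∈ S, ReflTransGen G.tailEdge v u) ∨ TransGen G.tailEdge v x from this _ h rfl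
  clear h
  intro m h
  induction h with
  | nil => simp
  | @step u v m n s m₁ m₂ hu he hp ih =>
    rintro ⟨⟩
    have hvu : G.tailEdge v u := ⟨m₁, hG.symm he⟩
    rcases m with - | - | -
    · cases hu
      exact .inr (.single hvu)
    · rcases ih rfl with ⟨t, ht, hut⟩ | hux
      · exact .inl ⟨t, ht, .head hvu hut⟩
      · exact .inr (.head hvu hux)
    · obtain ⟨a, k, ha⟩ := hu.exists_arrow
      cases m₁
      · exact absurd (hG.eq_arrow_of_tail ha he) (by simp)
      · exact .inl ⟨u, hp.mem, .single hvu⟩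

end Reaches

/-- There is a walk from `x` ending at `v` with mark `m`, whose vertices before `v` satisfy
`Passes C S`. -/
def Joins (G : MixedGraph V) (C S : Set V) (x v : V) (m : Option Mark) : Prop :=
  ∃ n s, G.Reaches C S (fun _ => 0) x v m n s

section Joins

variable {C S : Set V} {d : V → ℕ} {x y v w : V} {m : Option Mark} {m₁ m₂ : Mark} {n s : ℕ}

lemma Joins.nil : G.Joins C S x x none := ⟨_, _, .nil⟩

lemma Joins.step (h : G.Joins C S x v m) (he : G.edge v w m₁ m₂)
    (hv : Passes C S v m (some m₁)) : G.Joins C S x w (some m₂) := by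
  obtain ⟨n, s, h⟩ := h
  exact ⟨_, _, h.step he hv⟩

lemma Reaches.joins (h : G.Reaches C S d x v m n s) : G.Joins C S x v m := by
  induction h with
  | nil => exact .nil
  | step _ he hv ih => exact ih.step he hv

lemma subset_ancSet : C ⊆ G.ancSet C := fun v hv => ⟨v, hv, .refl⟩

lemma Joins.extend (h : G.Joins C S x v m) (hvy : G.ancestor v y) (hv : v ∉ G.ancSet C) :
    ∃ m', G.Joins C S x y m' := by
  induction hvy using ReflTransGen.head_induction_on generalizing m with
  | refl => exact ⟨m, h⟩
  | head hvu _ ih =>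
    refine ih (h.step hvu (passes_tail fun hC => hv (subset_ancSet hC))) ?_
    rintro ⟨c, hc, huc⟩
    exact hv ⟨c, hc, .head hvu huc⟩

lemma IsAncestral.joins_of_ancestor (hG : G.IsAncestral) (hvx : G.ancestor v x)
    (hv : v ∉ G.ancSet C) : ∃ m, m ≠ some .arrow ∧ G.Joins C S x v m := by
  induction hvx using ReflTransGen.head_induction_on with
  | refl => exact ⟨none, by simp, .nil⟩
  | @head v u hvu _ ih =>
    have hu : u ∉ G.ancSet C := by
      rintro ⟨c, hc, huc⟩
      exact hv ⟨c, hc, .head hvu huc⟩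
    obtain ⟨m, hm, hj⟩ := ih hu
    exact ⟨some .tail, by simp, hj.step (hG.symm hvu)
      (passes_of_notMem (fun hC => hu (subset_ancSet hC)) fun h => hm h.1)⟩

/-- Colliders of a connecting walk may be allowed to be ancestors of its endpoints. -/
lemma Joins.of_ancSet_union (hG : G.IsAncestral)
    (h : G.Joins C (G.ancSet (C ∪ {x, y})) x y m) : ∃ m', G.Joins C (G.ancSet C) x y m' := by
  have towards_origin : ∀ v m n s,
      G.Reaches C (G.ancSet (C ∪ {x, y})) (fun _ => 0) x v m n s →
        G.Joins C (G.ancSet C ∪ {u | G.ancestor u y}) x v m := by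
    intro v m n s h
    induction h with
    | nil => exact .nil
    | @step v w m n s m₁ m₂ _ he hv ih =>
      by_cases hm : m = some .arrow ∧ some m₁ = some Mark.arrow
      · obtain ⟨rfl, hm₁⟩ := hm
        cases hm₁
        by_cases hvS : v ∈ G.ancSet C ∪ {u | G.ancestor u y}
        · exact ih.step he (.inl ⟨rfl, rfl, hvS⟩)
        · have hvC : v ∉ G.ancSet C := fun h => hvS (.inl h)
          have hvx : G.ancestor v x := by
            obtain ⟨c, (hc | rfl | rfl), hvc⟩ := hv.mem
            · exact (hvC ⟨c, hc, hvc⟩).elim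
            · exact hvc
            · exact (hvS (.inr hvc)).elim
          obtain ⟨m', hm', hj⟩ := hG.joins_of_ancestor
            (S := G.ancSet C ∪ {u | G.ancestor u y}) hvx hvC
          exact hj.step he (passes_of_notMem (fun h => hvC (subset_ancSet h)) fun h => hm' h.1)
      · exact ih.step he (passes_of_notMem (hv.notMem hm) hm)
  have towards_end : ∀ v m n s,
      G.Reaches C (G.ancSet C ∪ {u | G.ancestor u y}) (fun _ => 0) x v m n s →
        G.Joins C (G.ancSet C) x v m ∨ ∃ m', G.Joins C (G.ancSet C) x y m' := by
    intro v m n s h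
    induction h with
    | nil => exact .inl .nil
    | @step v w m n s m₁ m₂ _ he hv ih =>
      rcases ih with ih | ih
      · by_cases hm : m = some .arrow ∧ some m₁ = some Mark.arrow
        · obtain ⟨rfl, hm₁⟩ := hm
          cases hm₁
          by_cases hvS : v ∈ G.ancSet C
          · exact .inl (ih.step he (.inl ⟨rfl, rfl, hvS⟩))
          · rcases hv.mem with hv | hv
            · exact (hvS hv).elim
            · exact .inr (ih.extend hv hvS)
        · exact .inl (ih.step he (passes_of_notMem (hv.notMem hm) hm))
      · exact .inr ih
  obtain ⟨n, s, h⟩ := h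
  obtain ⟨n, s, h⟩ := towards_origin _ _ _ _ h
  rcases towards_end _ _ _ _ h with h | h
  · exact ⟨_, h⟩
  · exact h

end Joins

namespace MWalk

/-- The mark with which the walk enters its `i`-th vertex. -/
def inMark (w : MWalk G) (i : ℕ) : Option Mark := if i = 0 then none else some (w.mk₂ (i - 1))

/-- The mark with which the walk leaves its `i`-th vertex. -/
def outMark (w : MWalk G) (i : ℕ) : Option Mark := if i < w.len then some (w.mk₁ i) else none

/-- The `i`-th vertex of the walk satisfies `Passes C S`. -/
def PassesAt (w : MWalk G) (C S : Set V) (i : ℕ) : Prop :=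
  Passes C S (w.vtx i) (w.inMark i) (w.outMark i)

/-- The contribution of the `i`-th vertex of the walk to its weight. -/
def cost (w : MWalk G) (d : V → ℕ) (i : ℕ) : ℕ :=
  colliderCost d (w.vtx i) (w.inMark i) (w.outMark i)

variable {C S : Set V} {d : V → ℕ} {i t : ℕ}

@[simp] lemma inMark_zero (w : MWalk G) : w.inMark 0 = none := rfl

@[simp] lemma inMark_succ (w : MWalk G) (i : ℕ) : w.inMark (i + 1) = some (w.mk₂ i) := rfl

@[simp] lemma outMark_len (w : MWalk G) : w.outMark w.len = none := by simp [outMark]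

lemma outMark_of_lt (w : MWalk G) (h : i < w.len) : w.outMark i = some (w.mk₁ i) := by
  simp [outMark, h]

lemma colliderAt_iff (w : MWalk G) :
    w.colliderAt i ↔ w.inMark i = some .arrow ∧ w.outMark i = some .arrow := by
  rcases i with - | i
  · simp [colliderAt]
  · simp only [colliderAt, inMark_succ, outMark]
    split_ifs with h <;> simp [h]

lemma mConnecting_iff (w : MWalk G) :
    w.mConnecting C ↔ ∀ i ≤ w.len, w.PassesAt C (G.ancSet C) i := by
  simp only [mConnecting, PassesAt, Passes, colliderAt_iff, ancSet, Set.mem_ofPred_eq]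
  constructor
  · rintro ⟨h, h'⟩ i hi
    by_cases hc : w.inMark i = some .arrow ∧ w.outMark i = some .arrow
    · exact .inl ⟨hc.1, hc.2, h i hc⟩
    · exact .inr ⟨hc, h' i hi hc⟩
  · intro h
    refine ⟨fun i hi => ?_, fun i hi hc => ?_⟩
    · have hlt : i < w.len := (w.colliderAt_iff.2 hi).2.1
      rcases h i hlt.le with h | h
      · exact h.2.2
      · exact (h.1 hi).elim
    · rcases h i hi with h | h
      · exact (hc ⟨h.1, h.2.1⟩).elim
      · exact h.2

lemma reaches_take (w : MWalk G) (hw : ∀ i < w.len, w.PassesAt C S i) (ht : t ≤ w.len) :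
    G.Reaches C S d (w.vtx 0) (w.vtx t) (w.inMark t) t (∑ i ∈ Finset.range t, w.cost d i) := by
  induction t with
  | zero => exact .nil
  | succ t ih =>
    have hp := hw t ht
    have := (ih (by omega)).step (w.isEdge t ht) (by rwa [PassesAt, w.outMark_of_lt ht] at hp)
    rw [← w.outMark_of_lt ht, ← inMark_succ] at this
    rw [Finset.sum_range_succ]
    exact this

lemma reaches_drop (hG : G.IsAncestral) (w : MWalk G)
    (hw : ∀ i, 0 < i → i ≤ w.len → w.PassesAt C S i) (ht : t ≤ w.len) :
    ∃ s, G.Reaches C S d (w.vtx w.len) (w.vtx t) (w.outMark t) (w.len - t) s ∧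
      ∑ i ∈ Finset.range t, w.cost d i + w.cost d t + s =
        ∑ i ∈ Finset.range (w.len + 1), w.cost d i := by
  induction ht using Nat.decreasingInduction with
  | self => exact ⟨0, by simpa using .nil, by simp [Finset.sum_range_succ]⟩
  | of_succ t ht ih =>
    obtain ⟨s, h, hs⟩ := ih
    have hp := hw (t + 1) (by omega) ht
    refine ⟨s + w.cost d (t + 1), ?_, ?_⟩
    · have := h.step (hG.symm (w.isEdge t ht)) (by simpa [PassesAt] using hp.symm)
      rw [← inMark_succ, colliderCost_symm] at this
      rw [w.outMark_of_lt ht]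
      rw [show w.len - t = w.len - (t + 1) + 1 by omega]
      exact this
    · rw [← hs, Finset.sum_range_succ]
      ring

lemma joins_segment (w : MWalk G) (hw : ∀ i < w.len, w.PassesAt C S i) (hi : w.vtx i ∉ C)
    (hit : i < t) (ht : t ≤ w.len) : G.Joins C S (w.vtx i) (w.vtx t) (w.inMark t) := by
  induction t, hit using Nat.le_induction with
  | base => exact Joins.nil.step (w.isEdge i ht) (passes_none hi)
  | succ t hit ih =>
    have hp := hw t ht
    exact (ih (by omega)).step (w.isEdge t ht) (by rwa [PassesAt, w.outMark_of_lt ht] at hp)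

/-- Appending an edge to a walk. -/
def snoc (w : MWalk G) (v : V) (m₁ m₂ : Mark) (h : G.edge (w.vtx w.len) v m₁ m₂) : MWalk G where
  len := w.len + 1
  vtx i := if i ≤ w.len then w.vtx i else v
  mk₁ i := if i < w.len then w.mk₁ i else m₁
  mk₂ i := if i < w.len then w.mk₂ i else m₂
  isEdge i hi := by
    rcases (Nat.lt_succ_iff.1 hi).lt_or_eq with hi | rfl
    · simpa [hi, hi.le, Nat.succ_le_iff] using w.isEdge i hi
    · simpa using h

/-- The reverse of a walk. -/
def reverse (hG : G.IsAncestral) (w : MWalk G) : MWalk G where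
  len := w.len
  vtx i := w.vtx (w.len - i)
  mk₁ i := w.mk₂ (w.len - 1 - i)
  mk₂ i := w.mk₁ (w.len - 1 - i)
  isEdge i hi := by
    have := hG.symm (w.isEdge (w.len - 1 - i) (by omega))
    rw [show w.len - 1 - i + 1 = w.len - i by omega] at this
    rwa [show w.len - (i + 1) = w.len - 1 - i by omega]

lemma inMark_reverse (hG : G.IsAncestral) (w : MWalk G) (hi : i ≤ w.len) :
    (w.reverse hG).inMark i = w.outMark (w.len - i) := by
  rcases i with - | i
  · simp
  · rw [inMark_succ, outMark_of_lt _ (by omega)]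
    simp only [reverse]
    congr 2
    omega

lemma outMark_reverse (hG : G.IsAncestral) (w : MWalk G) (hi : i ≤ w.len) :
    (w.reverse hG).outMark i = w.inMark (w.len - i) := by
  rcases hi.lt_or_eq with hi | rfl
  · rw [outMark_of_lt (w.reverse hG) hi, show w.len - i = w.len - 1 - i + 1 by omega, inMark_succ]
    rfl
  · simp [outMark, reverse]

end MWalk

lemma Reaches.exists_walk {C S : Set V} {d : V → ℕ} {x v : V} {m : Option Mark} {n s : ℕ}
    (h : G.Reaches C S d x v m n s) :
    ∃ w : MWalk G, w.len = n ∧ w.vtx 0 = x ∧ w.vtx w.len = v ∧ w.inMark w.len = m ∧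
      (∀ i < w.len, w.PassesAt C S i) ∧ ∑ i ∈ Finset.range w.len, w.cost d i = s := by
  induction h with
  | nil => exact ⟨⟨0, fun _ => x, fun _ => .tail, fun _ => .tail, by simp⟩, by simp⟩
  | @step v u m n s m₁ m₂ _ he hp ih =>
    obtain ⟨w, rfl, rfl, rfl, rfl, hw, rfl⟩ := ih
    have hv : ∀ i ≤ w.len, (w.snoc u m₁ m₂ he).vtx i = w.vtx i := fun i hi => by
      simp [MWalk.snoc, hi]
    have hin : ∀ i ≤ w.len, (w.snoc u m₁ m₂ he).inMark i = w.inMark i := by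
      rintro (- | i) hi
      · rfl
      · simp [MWalk.snoc, Nat.lt_of_succ_le hi]
    have hout : ∀ i < w.len, (w.snoc u m₁ m₂ he).outMark i = w.outMark i := fun i hi => by
      simp [MWalk.snoc, MWalk.outMark, hi, hi.trans (Nat.lt_succ_self _)]
    have hlast : (w.snoc u m₁ m₂ he).outMark w.len = some m₁ := by
      simp [MWalk.snoc, MWalk.outMark]
    refine ⟨w.snoc u m₁ m₂ he, rfl, hv 0 (Nat.zero_le _), by simp [MWalk.snoc],
      by simp [MWalk.snoc, MWalk.inMark], fun i hi => ?_, ?_⟩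
    · rcases (Nat.lt_succ_iff.1 hi).lt_or_eq with hi | rfl
      · rw [MWalk.PassesAt, hv i hi.le, hin i hi.le, hout i hi]
        exact hw i hi
      · rw [MWalk.PassesAt, hv _ le_rfl, hin _ le_rfl, hlast]
        exact hp
    · change ∑ i ∈ Finset.range (w.len + 1), _ = _
      rw [Finset.sum_range_succ, MWalk.cost, hv _ le_rfl, hin _ le_rfl, hlast]
      congr 1
      refine Finset.sum_congr rfl fun i hi => ?_
      have hi := Finset.mem_range.1 hi
      rw [MWalk.cost, hv i hi.le, hin i hi.le, hout i hi, MWalk.cost]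

/-! ### Shortest connecting walks -/

/-- A walk which is m-connecting given `C`, has as few edges as possible among the m-connecting
walks with the same endpoints, and minimizes the total weight of its colliders among those. -/
structure MWalk.IsShortest (w : MWalk G) (C : Set V) (d : V → ℕ) : Prop where
  passes : ∀ i ≤ w.len, w.PassesAt C (G.ancSet C) i
  le_of_reaches : ∀ m n s, G.Reaches C (G.ancSet C) d (w.vtx 0) (w.vtx w.len) m n s →
    w.len ≤ n ∧ (n = w.len → ∑ i ∈ Finset.range (w.len + 1), w.cost d i ≤ s)

section Shortest

variable {C S : Set V} {d : V → ℕ} {x y : V} {m : Option Mark}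

lemma Joins.exists_reaches (h : G.Joins C S x y m) (d : V → ℕ) :
    ∃ n s, G.Reaches C S d x y m n s := by
  obtain ⟨n, s, h⟩ := h
  induction h with
  | nil => exact ⟨_, _, .nil⟩
  | step _ he hp ih =>
    obtain ⟨n, s, ih⟩ := ih
    exact ⟨_, _, ih.step he hp⟩

lemma Joins.exists_isShortest (h : G.Joins C (G.ancSet C) x y m) (hy : y ∉ C) (d : V → ℕ) :
    ∃ w : MWalk G, w.IsShortest C d ∧ w.vtx 0 = x ∧ w.vtx w.len = y := by
  classical
  have h₁ : ∃ n s m, G.Reaches C (G.ancSet C) d x y m n s := by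
    obtain ⟨n, s, h⟩ := h.exists_reaches d
    exact ⟨n, s, m, h⟩
  have h₂ := Nat.find_spec h₁
  obtain ⟨m, h⟩ := Nat.find_spec h₂
  obtain ⟨w, hn, rfl, rfl, -, hw, hs⟩ := h.exists_walk
  refine ⟨w, ⟨fun i hi => ?_, fun m' n' s' h' => ⟨?_, ?_⟩⟩, rfl, rfl⟩
  · rcases hi.lt_or_eq with hi | rfl
    · exact hw i hi
    · rw [MWalk.PassesAt, MWalk.outMark_len]
      exact passes_none_right hy
  · rw [hn]
    exact Nat.find_min' h₁ ⟨s', m', h'⟩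
  · intro hn'
    have h' : G.Reaches C (G.ancSet C) d (w.vtx 0) (w.vtx w.len) m' (Nat.find h₁) s' :=
      (hn'.trans hn) ▸ h'
    rw [Finset.sum_range_succ, hs, MWalk.cost, MWalk.outMark_len]
    simp only [colliderCost, reduceCtorEq, and_false, if_false, add_zero]
    exact Nat.find_min' h₂ ⟨m', h'⟩

lemma MWalk.exists_edge_of_inMark {w : MWalk G} {i : ℕ} {k : Mark} (h : w.inMark i = some k)
    (hi : i ≤ w.len) : ∃ a m, G.edge a (w.vtx i) m k := by
  rcases i with - | i
  · simp at h
  · rw [inMark_succ] at h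
    cases h
    exact ⟨_, _, w.isEdge i hi⟩

lemma MWalk.PassesAt.notMem_zero {w : MWalk G} (h : w.PassesAt C S 0) : w.vtx 0 ∉ C :=
  Passes.notMem_none h

lemma MWalk.PassesAt.notMem_len {w : MWalk G} (h : w.PassesAt C S w.len) : w.vtx w.len ∉ C :=
  Passes.notMem h (by simp)

lemma MWalk.IsShortest.isPath (hG : G.IsAncestral) {w : MWalk G} (hw : w.IsShortest C d) :
    w.IsPath := by
  have key : ∀ i j, i < j → j ≤ w.len → w.vtx i ≠ w.vtx j := by
    intro i j hij hj he
    have hpi := hw.passes i (by omega)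
    have hpj := hw.passes j hj
    have hp : Passes C (G.ancSet C) (w.vtx i) (w.inMark i) (w.outMark j) := by
      by_cases hi : w.inMark i = some .arrow
      · by_cases hj' : w.outMark j = some .arrow
        · refine .inl ⟨hi, hj', ?_⟩
          by_cases hio : w.outMark i = some .arrow
          · exact Passes.mem (by rwa [MWalk.PassesAt, hi, hio] at hpi)
          by_cases hjo : w.inMark j = some .arrow
          · rw [he]
            exact Passes.mem (by rwa [MWalk.PassesAt, hj', hjo] at hpj)
          have hj_in : w.inMark j = some .tail := by
            obtain ⟨j, rfl⟩ : ∃ k, j = k + 1 := ⟨j - 1, by omega⟩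
            rw [MWalk.inMark_succ] at hjo ⊢
            cases h : w.mk₂ j
            · rfl
            · simp [h] at hjo
          have hseg := w.joins_segment (fun k hk => hw.passes k hk.le)
            (hpi.notMem fun h => hio h.2) hij hj
          rw [hj_in] at hseg
          obtain ⟨n, s, hseg⟩ := hseg
          obtain ⟨a, k, ha⟩ := MWalk.exists_edge_of_inMark hi (by omega)
          rcases hseg.anterior hG with ⟨u, ⟨c, hc, huc⟩, hju⟩ | hji
          · rw [← he] at hju
            exact ⟨c, hc, (hG.ancestor_of_tailEdge ha hju).trans huc⟩
          · rw [← he] at hji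
            exact (hG.2.1 _ (hG.transGen_dirEdge_of_tailEdge ha hji)).elim
        · refine passes_of_notMem ?_ fun h => hj' h.2
          rw [he]
          exact hpj.notMem fun h => hj' h.2
      · exact passes_of_notMem (hpi.notMem fun h => hi h.1) fun h => hi h.1
    obtain ⟨s, hdrop, -⟩ := w.reaches_drop hG (d := d) (fun k _ hk => hw.passes k hk) hj
    have htake := w.reaches_take (d := d) (fun k hk => hw.passes k hk.le) (hij.le.trans hj)
    rw [← he] at hdrop
    obtain ⟨k, hk⟩ := htake.join hG hdrop hp
    have := (hw.le_of_reaches _ _ _ hk).1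
    omega
  intro i j hi hj he
  rcases lt_trichotomy i j with h | h | h
  · exact (key i j h hj he).elim
  · exact h
  · exact (key j i h hi he.symm).elim

lemma Joins.mConnected (hG : G.IsAncestral) (h : G.Joins C (G.ancSet C) x y m) (hy : y ∉ C) :
    G.mConnected x y C := by
  obtain ⟨w, hw, hx, hy⟩ := h.exists_isShortest hy fun _ => 0
  exact ⟨w, hw.isPath hG, hx, hy, w.mConnecting_iff.2 hw.passes⟩

lemma mConnected.exists_joins (h : G.mConnected x y C) :
    x ∉ C ∧ y ∉ C ∧ ∃ m, G.Joins C (G.ancSet C) x y m := by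
  obtain ⟨w, -, rfl, rfl, hw⟩ := h
  rw [MWalk.mConnecting_iff] at hw
  exact ⟨(hw 0 (Nat.zero_le _)).notMem_zero, (hw _ le_rfl).notMem_len, _,
    (w.reaches_take (d := fun _ => 0) (fun i hi => hw i hi.le) le_rfl).joins⟩

end Shortest

lemma markovEquiv_iff : MarkovEquiv G H ↔
    ∀ a b C, a ≠ b → (G.mConnected a b C ↔ H.mConnected a b C) := by
  constructor
  · intro h a b C hab
    have := h {a} {b} C
    simp only [indep, Set.disjoint_singleton, ne_eq, hab, not_false_eq_true, true_and, mSep,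
      Set.mem_singleton_iff, forall_eq] at this
    exact not_iff_not.1 this
  · intro h A B C
    refine and_congr_right fun hAB => ?_
    refine forall₂_congr fun a ha => forall₂_congr fun b hb => not_congr (h a b C ?_)
    rintro rfl
    exact hAB.notMem_of_mem_left ha hb

/-! ### Inducing walks -/

/-- An inducing walk between `a` and `b`: a walk all of whose interior vertices are colliders and
ancestors of `a` or `b`. -/
def InducingWalk (G : MixedGraph V) (a b : V) : Prop :=
  ∃ w : MWalk G, w.vtx 0 = a ∧ w.vtx w.len = b ∧ ∀ i, i + 1 < w.len →
    w.mk₂ i = .arrow ∧ w.mk₁ (i + 1) = .arrow ∧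
      (G.ancestor (w.vtx (i + 1)) a ∨ G.ancestor (w.vtx (i + 1)) b)

/-- Every two distinct nonadjacent vertices have no inducing walk between them. -/
def NoInducingWalk (G : MixedGraph V) : Prop :=
  ∀ a b, a ≠ b → ¬ G.adj a b → ¬ G.InducingWalk a b

section Inducing

variable {a b : V}

lemma InducingWalk.symm (hG : G.IsAncestral) (h : G.InducingWalk a b) : G.InducingWalk b a := by
  obtain ⟨w, rfl, rfl, hw⟩ := h
  refine ⟨w.reverse hG, by simp [MWalk.reverse], by simp [MWalk.reverse], fun i hi => ?_⟩
  have hi : i + 1 < w.len := hi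
  obtain ⟨h₁, h₂, h₃⟩ := hw (w.len - 1 - (i + 1)) (by omega)
  rw [show w.len - 1 - (i + 1) + 1 = w.len - 1 - i by omega] at h₂ h₃
  refine ⟨h₂, h₁, ?_⟩
  simp only [MWalk.reverse, show w.len - (i + 1) = w.len - 1 - i by omega]
  exact h₃.symm

/-- An inducing walk between nonadjacent vertices of an ancestral graph is bidirected, and
neither of its endpoints is an ancestor of the other. -/
lemma InducingWalk.exists_bidirected (hG : G.IsAncestral) (hab : a ≠ b) (hn : ¬ G.adj a b)
    (h : G.InducingWalk a b) : ∃ w : MWalk G, w.vtx 0 = a ∧ w.vtx w.len = b ∧ 2 ≤ w.len ∧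
      (∀ i < w.len, w.mk₁ i = .arrow ∧ w.mk₂ i = .arrow) ∧
      (∀ i, 0 < i → i < w.len → G.ancestor (w.vtx i) a ∨ G.ancestor (w.vtx i) b) ∧
      G.ancestor (w.vtx 1) b ∧ G.ancestor (w.vtx (w.len - 1)) a ∧
      ¬ G.ancestor a b ∧ ¬ G.ancestor b a := by
  obtain ⟨w, rfl, rfl, hw⟩ := h
  have hlen : 2 ≤ w.len := by
    by_contra! hlt
    interval_cases h : w.len
    · exact hab rfl
    · exact hn ⟨_, _, w.isEdge 0 (by omega)⟩
  have hanc : ∀ i, 0 < i → i < w.len →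
      G.ancestor (w.vtx i) (w.vtx 0) ∨ G.ancestor (w.vtx i) (w.vtx w.len) := by
    intro i h0 hi
    obtain ⟨i, rfl⟩ : ∃ k, i = k + 1 := ⟨i - 1, by omega⟩
    exact (hw i hi).2.2
  have hfirst := w.isEdge 0 (by omega)
  rw [(hw 0 (by omega)).1] at hfirst
  have hlast := w.isEdge (w.len - 1) (by omega)
  rw [Nat.sub_add_cancel (by omega)] at hlast
  have hlast' : w.mk₁ (w.len - 1) = .arrow := by
    have := (hw (w.len - 2) (by omega)).2.1
    rwa [show w.len - 2 + 1 = w.len - 1 by omega] at this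
  rw [hlast'] at hlast
  have h1 : G.ancestor (w.vtx 1) (w.vtx w.len) :=
    (hanc 1 one_pos (by omega)).resolve_left (hG.not_ancestor_of_arrow hfirst)
  have hn1 : G.ancestor (w.vtx (w.len - 1)) (w.vtx 0) :=
    (hanc (w.len - 1) (by omega) (by omega)).resolve_right
      (hG.not_ancestor_of_arrow (hG.symm hlast))
  have hna : ¬ G.ancestor (w.vtx 0) (w.vtx w.len) := fun h =>
    hG.not_ancestor_of_arrow (hG.symm hlast) (hn1.trans h)
  have hnb : ¬ G.ancestor (w.vtx w.len) (w.vtx 0) := fun h =>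
    hG.not_ancestor_of_arrow hfirst (h1.trans h)
  refine ⟨w, rfl, rfl, hlen, fun i hi => ⟨?_, ?_⟩, hanc, h1, hn1, hna, hnb⟩
  · rcases i with - | i
    · cases h : w.mk₁ 0
      · rw [h] at hfirst
        exact (hna (.head hfirst h1)).elim
      · rfl
    · exact (hw i hi).2.1
  · by_cases hi' : i + 1 < w.len
    · exact (hw i hi').1
    · obtain rfl : i = w.len - 1 := by omega
      cases h : w.mk₂ (w.len - 1)
      · rw [h] at hlast
        exact (hnb (.head (hG.symm hlast) hn1)).elim
      · rfl

/-- The proper anterior set of `{a, b}`. -/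
def separator (G : MixedGraph V) (a b : V) : Set V :=
  {v | (ReflTransGen G.tailEdge v a ∨ ReflTransGen G.tailEdge v b) ∧ v ≠ a ∧ v ≠ b}

lemma inducingWalk_of_mConnected_separator (hG : G.IsAncestral)
    (h : G.mConnected a b (G.separator a b)) : G.InducingWalk a b := by
  obtain ⟨w, hpath, rfl, rfl, hw⟩ := h
  rw [MWalk.mConnecting_iff] at hw
  set C := G.separator (w.vtx 0) (w.vtx w.len) with hC
  have hanc : ∀ u ∈ G.ancSet C, ReflTransGen G.tailEdge u (w.vtx 0) ∨
      ReflTransGen G.tailEdge u (w.vtx w.len) := by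
    rintro u ⟨c, ⟨hc, -⟩, huc⟩
    exact hc.imp (tailEdge_of_ancestor huc).trans (tailEdge_of_ancestor huc).trans
  refine ⟨w, rfl, rfl, fun i hi => ?_⟩
  have hp := hw (i + 1) hi.le
  have hmem : ReflTransGen G.tailEdge (w.vtx (i + 1)) (w.vtx 0) ∨
      ReflTransGen G.tailEdge (w.vtx (i + 1)) (w.vtx w.len) → w.vtx (i + 1) ∈ C := fun h =>
    ⟨h, fun h => by have := hpath _ _ hi.le (Nat.zero_le _) h; omega,
      fun h => by have := hpath _ _ hi.le le_rfl h; omega⟩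
  have hin : w.mk₂ i = .arrow := by
    cases hm : w.mk₂ i
    · have ht := w.reaches_take (d := fun _ => 0) (fun k hk => hw k hk.le) hi.le
      rw [MWalk.inMark_succ, hm] at ht
      refine (hp.notMem (by simp [hm]) (hmem ?_)).elim
      rcases ht.anterior hG with ⟨u, hu, hvu⟩ | hv
      · exact (hanc u hu).imp hvu.trans hvu.trans
      · exact .inl hv.to_reflTransGen
    · rfl
  have hout : w.mk₁ (i + 1) = .arrow := by
    cases hm : w.mk₁ (i + 1)
    · obtain ⟨s, ht, -⟩ := w.reaches_drop hG (d := fun _ => 0) (fun k _ hk => hw k hk) hi.le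
      rw [w.outMark_of_lt hi, hm] at ht
      refine (hp.notMem (by simp [w.outMark_of_lt hi, hm]) (hmem ?_)).elim
      rcases ht.anterior hG with ⟨u, hu, hvu⟩ | hv
      · exact (hanc u hu).imp hvu.trans hvu.trans
      · exact .inr hv.to_reflTransGen
    · rfl
  refine ⟨hin, hout, ?_⟩
  rw [MWalk.PassesAt, MWalk.inMark_succ, w.outMark_of_lt hi, hin, hout] at hp
  have he := w.isEdge i (by omega)
  rw [hin] at he
  exact (hanc _ hp.mem).imp (hG.ancestor_of_tailEdge he) (hG.ancestor_of_tailEdge he)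

lemma NoInducingWalk.not_mConnected_separator (hG : G.IsAncestral) (h : G.NoInducingWalk)
    (hab : a ≠ b) (hn : ¬ G.adj a b) : ¬ G.mConnected a b (G.separator a b) := fun hc =>
  h a b hab hn (inducingWalk_of_mConnected_separator hG hc)

end Inducing

/-! ### Adding edges between the endpoints of inducing walks -/

/-- `K` arises from `G` by adding bidirected edges between the endpoints of inducing walks. -/
structure IsInducingExtension (G K : MixedGraph V) : Prop where
  subgraph : Subgraph G K
  edge_or : ∀ a b m₁ m₂, K.edge a b m₁ m₂ → G.edge a b m₁ m₂ ∨
    (m₁ = .arrow ∧ m₂ = .arrow ∧ a ≠ b ∧ ¬ G.adj a b ∧ G.InducingWalk a b)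

lemma IsInducingExtension.dirEdge_eq (h : IsInducingExtension G K) : K.dirEdge = G.dirEdge := by
  ext a b
  refine ⟨fun hab => ?_, h.subgraph _ _ _ _⟩
  rcases h.edge_or _ _ _ _ hab with hab | hab
  · exact hab
  · exact absurd hab.1 (by simp)

lemma IsInducingExtension.undirEdge_eq (h : IsInducingExtension G K) :
    K.undirEdge = G.undirEdge := by
  ext a b
  refine ⟨fun hab => ?_, h.subgraph _ _ _ _⟩
  rcases h.edge_or _ _ _ _ hab with hab | hab
  · exact hab
  · exact absurd hab.1 (by simp)

lemma IsInducingExtension.ancestor_eq (h : IsInducingExtension G K) :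
    K.ancestor = G.ancestor := by
  unfold ancestor
  rw [h.dirEdge_eq]

lemma IsInducingExtension.ancSet_eq (h : IsInducingExtension G K) : K.ancSet = G.ancSet := by
  unfold ancSet
  rw [h.ancestor_eq]

lemma IsInducingExtension.selectionAdjacent_iff (h : IsInducingExtension G K) {a : V} :
    K.selectionAdjacent a ↔ G.selectionAdjacent a := by
  simp only [selectionAdjacent, h.undirEdge_eq]

lemma isInducingExtension_addEdge (hG : G.IsAncestral) {a b : V} (hab : a ≠ b)
    (hn : ¬ G.adj a b) (hi : G.InducingWalk a b) :
    IsInducingExtension G (G.addEdge a b .arrow .arrow) where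
  subgraph _ _ _ _ h := .inl h
  edge_or := by
    rintro x y m₁ m₂ (h | ⟨rfl, rfl, rfl, rfl⟩ | ⟨rfl, rfl, rfl, rfl⟩)
    · exact .inl h
    · exact .inr ⟨rfl, rfl, hab, hn, hi⟩
    · exact .inr ⟨rfl, rfl, hab.symm, fun h => hn (hG.adj_symm h), hi.symm hG⟩

lemma IsInducingExtension.isAncestral (hG : G.IsAncestral) (h : IsInducingExtension G K)
    (hK : ∀ a b m₁ m₂, K.edge a b m₁ m₂ → K.edge b a m₂ m₁) : K.IsAncestral := by
  refine ⟨⟨hK, fun a m₁ m₂ ha => ?_⟩, ?_, fun a b hab => ?_, fun a ha b m hb => ?_⟩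
  · rcases h.edge_or _ _ _ _ ha with ha | ha
    · exact hG.1.2 _ _ _ ha
    · exact ha.2.2.1 rfl
  · rw [h.dirEdge_eq]
    exact hG.2.1
  · rw [h.dirEdge_eq]
    rcases h.edge_or _ _ _ _ hab with hab | ⟨-, -, hne, hn, hi⟩
    · exact hG.2.2.1 a b hab
    · obtain ⟨w, -, -, -, -, -, -, -, h₁, h₂⟩ := hi.exists_bidirected hG hne hn
      exact ⟨fun h => h₁ h.to_reflTransGen, fun h => h₂ h.to_reflTransGen⟩
  · rw [h.selectionAdjacent_iff] at ha
    rcases h.edge_or _ _ _ _ hb with hb | ⟨-, -, hne, hn, hi⟩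
    · exact hG.2.2.2 a ha b m hb
    · obtain ⟨w, -, rfl, hlen, hw, -⟩ := hi.exists_bidirected hG hne hn
      have := w.isEdge (w.len - 1) (by omega)
      rw [Nat.sub_add_cancel (by omega), (hw (w.len - 1) (by omega)).2] at this
      exact hG.2.2.2 _ ha _ _ this

lemma Passes.mono {C S T : Set V} {v : V} {m n : Option Mark} (h : Passes C S v m n)
    (hST : S ⊆ T) : Passes C T v m n :=
  h.imp (fun h => ⟨h.1, h.2.1, hST h.2.2⟩) id

lemma ancSet_mono {C D : Set V} (h : C ⊆ D) : G.ancSet C ⊆ G.ancSet D := by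
  rintro v ⟨c, hc, hv⟩
  exact ⟨c, h hc, hv⟩

/-- Following tails from a vertex of a connecting walk with an arrowhead leads to `C` or to an
endpoint of the walk. -/
lemma MWalk.mem_ancSet_of_arrow (hG : G.IsAncestral) {C : Set V} {w : MWalk G}
    (hw : ∀ i ≤ w.len, w.PassesAt C (G.ancSet C) i) {i : ℕ} (hi : i ≤ w.len) {a : V} {m : Mark}
    (ha : G.edge a (w.vtx i) m .arrow) :
    w.vtx i ∈ G.ancSet (C ∪ {w.vtx 0, w.vtx w.len}) := by
  have hC : G.ancSet C ⊆ G.ancSet (C ∪ {w.vtx 0, w.vtx w.len}) :=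
    ancSet_mono Set.subset_union_left
  have key : ∀ {z k n s}, G.Reaches C (G.ancSet C) (fun _ => 0) z (w.vtx i) k n s →
      k = some .tail → z ∈ ({w.vtx 0, w.vtx w.len} : Set V) →
        w.vtx i ∈ G.ancSet (C ∪ {w.vtx 0, w.vtx w.len}) := by
    rintro z k n s h rfl hz
    rcases h.anterior hG with ⟨u, ⟨c, hc, huc⟩, hu⟩ | h
    · exact ⟨c, .inl hc, (hG.ancestor_of_tailEdge ha hu).trans huc⟩
    · exact ⟨z, .inr hz, hG.ancestor_of_tailEdge ha h.to_reflTransGen⟩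
  rcases Nat.eq_zero_or_pos i with rfl | h0
  · exact subset_ancSet (by simp)
  rcases hi.lt_or_eq with hlt | rfl
  · have hin : w.inMark i = some (w.mk₂ (i - 1)) := by simp [inMark, h0.ne']
    have hout := w.outMark_of_lt hlt
    have htake := w.reaches_take (d := fun _ => 0) (fun k hk => hw k hk.le) hi
    obtain ⟨s, hdrop, -⟩ := w.reaches_drop hG (d := fun _ => 0) (fun k _ hk => hw k hk) hi
    cases h₁ : w.mk₂ (i - 1)
    · exact key htake (by rw [hin, h₁]) (by simp)
    cases h₂ : w.mk₁ i
    · exact key hdrop (by rw [hout, h₂]) (by simp)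
    · have := hw i hi
      rw [PassesAt, hin, hout, h₁, h₂] at this
      exact hC this.mem
  · exact subset_ancSet (by simp)

theorem IsInducingExtension.markovEquiv (hG : G.IsAncestral) (hK : K.IsAncestral)
    (h : IsInducingExtension G K) : MarkovEquiv G K := by
  refine markovEquiv_iff.2 fun x y C _ => ⟨?_, ?_⟩
  · rintro ⟨w, hpath, hx, hy, hw⟩
    refine ⟨⟨w.len, w.vtx, w.mk₁, w.mk₂, fun i hi => h.subgraph _ _ _ _ (w.isEdge i hi)⟩,
      hpath, hx, hy, fun i hi => ?_, hw.2⟩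
    rw [h.ancestor_eq]
    exact hw.1 i hi
  · rintro ⟨w, -, rfl, rfl, hw⟩
    rw [MWalk.mConnecting_iff] at hw
    set S := G.ancSet (C ∪ {w.vtx 0, w.vtx w.len})
    have hmem : ∀ {i a m}, i ≤ w.len → K.edge a (w.vtx i) m .arrow → w.vtx i ∈ S := by
      intro i a m hi ha
      have := MWalk.mem_ancSet_of_arrow hK hw hi ha
      rwa [h.ancSet_eq] at this
    have hjoins : ∀ t ≤ w.len, G.Joins C S (w.vtx 0) (w.vtx t) (w.inMark t) := by
      intro t
      induction t with
      | zero => exact fun _ => .nil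
      | succ t ih =>
        intro ht
        have hp := hw t (by omega)
        rw [MWalk.PassesAt, w.outMark_of_lt ht, h.ancSet_eq] at hp
        replace hp := hp.mono (T := S) (ancSet_mono Set.subset_union_left)
        have ih := ih (by omega)
        rcases h.edge_or _ _ _ _ (w.isEdge t ht) with he | ⟨h₁, h₂, hne, hn, hi⟩
        · exact ih.step he hp
        have hmem₁ : w.vtx t ∈ S := by
          have := hK.symm (w.isEdge t ht)
          rw [h₁] at this
          exact hmem (by omega) this
        have hmem₂ : w.vtx (t + 1) ∈ S := by
          have := w.isEdge t ht
          rw [h₂] at this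
          exact hmem ht this
        obtain ⟨q, hq0, hq1, hlen, hq, hanc, -⟩ := hi.exists_bidirected hG hne hn
        have hedge : ∀ k < q.len, G.edge (q.vtx k) (q.vtx (k + 1)) .arrow .arrow := by
          intro k hk
          have := q.isEdge k hk
          rwa [(hq k hk).1, (hq k hk).2] at this
        have hchain : ∀ k < q.len, G.Joins C S (w.vtx 0) (q.vtx (k + 1)) (some .arrow) := by
          intro k
          induction k with
          | zero =>
            intro hk
            have := hedge 0 hk
            rw [hq0] at this
            exact ih.step this (by rwa [h₁] at hp)
          | succ k ihk =>
            intro hk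
            refine (ihk (by omega)).step (hedge (k + 1) hk) (.inl ⟨rfl, rfl, ?_⟩)
            have aux : ∀ {u z : V}, z ∈ S → G.ancestor u z → u ∈ S := by
              rintro u z ⟨c, hc, hz⟩ hu
              exact ⟨c, hc, hu.trans hz⟩
            exact (hanc (k + 1) (by omega) hk).elim (aux hmem₁) (aux hmem₂)
        have := hchain (q.len - 1) (by omega)
        rwa [Nat.sub_add_cancel (by omega), hq1, ← h₂] at this
    obtain ⟨m, hj⟩ := (hjoins w.len le_rfl).of_ancSet_union hG
    exact hj.mConnected hG (hw _ le_rfl).notMem_len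

/-- Maximal ancestral graphs have no inducing walks between nonadjacent vertices. -/
lemma IsMaximal.noInducingWalk (hG : G.IsAncestral) (hmax : G.IsMaximal) :
    G.NoInducingWalk := by
  intro a b hab hn hi
  have hext := isInducingExtension_addEdge hG hab hn hi
  have hanc := hext.isAncestral hG <| by
    rintro x y m₁ m₂ (h | ⟨rfl, rfl, rfl, rfl⟩ | ⟨rfl, rfl, rfl, rfl⟩)
    · exact .inl (hG.symm h)
    · exact .inr (.inr ⟨rfl, rfl, rfl, rfl⟩)
    · exact .inr (.inl ⟨rfl, rfl, rfl, rfl⟩)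
  exact hmax a b hab hn _ _ fun A B C => (hext.markovEquiv hG hanc A B C).symm

lemma mConnected_of_edge {a b : V} {m₁ m₂ : Mark} {C : Set V} (hG : G.IsAncestral)
    (h : G.edge a b m₁ m₂) (ha : a ∉ C) (hb : b ∉ C) : G.mConnected a b C :=
  (Joins.nil.step h (passes_none ha)).mConnected hG hb

lemma IsMAGExtension.isInducingExtension (hG : G.IsAncestral) (h : IsMAGExtension G K) :
    IsInducingExtension G K where
  subgraph := h.1
  edge_or := by
    obtain ⟨hsub, hK, hequiv, -⟩ := h
    intro a b m₁ m₂ he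
    by_cases hadj : G.adj a b
    · obtain ⟨n₁, n₂, hadj⟩ := hadj
      obtain ⟨rfl, rfl⟩ := hK.simple _ _ _ _ _ _ he (hsub _ _ _ _ hadj)
      exact .inl hadj
    have hab := hK.ne he
    have hcon : G.mConnected a b (G.separator a b) :=
      (markovEquiv_iff.1 hequiv a b _ hab).2
        (mConnected_of_edge hK he (fun h => h.2.1 rfl) fun h => h.2.2 rfl)
    have hi := inducingWalk_of_mConnected_separator hG hcon
    obtain ⟨w, rfl, rfl, hlen, hw, -, h1, hn1, -⟩ := hi.exists_bidirected hG hab hadj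
    have hfirst := hsub _ _ _ _ (w.isEdge 0 (by omega))
    have hlast := hsub _ _ _ _ (w.isEdge (w.len - 1) (by omega))
    rw [Nat.sub_add_cancel (by omega)] at hlast
    rw [(hw _ (by omega)).1, (hw _ (by omega)).2] at hfirst hlast
    have hanc : ∀ {u v}, G.ancestor u v → K.ancestor u v := fun {u v} h =>
      ReflTransGen.mono (p := K.dirEdge) (fun _ _ h => hsub _ _ _ _ h) _ _ h
    refine .inr ⟨?_, ?_, hab, hadj, hi⟩
    · cases m₁
      · have := hK.dirEdge_of_tail (hK.symm hfirst) he
        exact (hK.not_ancestor_of_arrow (hK.symm hlast) ((hanc hn1).tail this)).elim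
      · rfl
    · cases m₂
      · have := hK.dirEdge_of_tail hlast (hK.symm he)
        exact (hK.not_ancestor_of_arrow hfirst ((hanc h1).tail this)).elim
      · rfl

/-! ### Colliders with order -/

section Order

variable {a b c i j k : V} {s t m : ℕ} {w : ℕ → V}

lemma colliderOrderLE.isCollider (h : G.colliderOrderLE t i j k) : G.isCollider i j k := by
  induction t with
  | zero => exact h.1
  | succ t ih =>
    rcases h with h | h
    · exact ih h
    · exact h.1

lemma hasColliderWithOrder.isCollider (h : G.hasColliderWithOrder i j k) : G.isCollider i j k := by
  obtain ⟨t, h⟩ := h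
  exact h.isCollider

lemma colliderOrderLE.mono (h : G.colliderOrderLE s i j k) (hst : s ≤ t) :
    G.colliderOrderLE t i j k := by
  induction hst with
  | refl => exact h
  | step _ ih => exact .inl ih

lemma colliderOrderLE.symm (hG : G.IsAncestral) (h : G.colliderOrderLE t i j k) :
    G.colliderOrderLE t k j i := by
  induction t with
  | zero => exact ⟨hG.isCollider_symm h.1, fun hadj => h.2 (hG.adj_symm hadj)⟩
  | succ t ih =>
    rcases h with h | ⟨h, m, w, hm, hw, h'⟩
    · exact .inl (ih h)
    · exact .inr ⟨hG.isCollider_symm h, m, w, hm, hw.symm, h'⟩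

lemma hasColliderWithOrder.symm (hG : G.IsAncestral) (h : G.hasColliderWithOrder i j k) :
    G.hasColliderWithOrder k j i := by
  obtain ⟨t, h⟩ := h
  exact ⟨t, h.symm hG⟩

/-- The graphs have the same adjacencies and, for distinct endpoints, the same colliders with
order. -/
structure SameOrderedColliders (G H : MixedGraph V) : Prop where
  adj_iff : ∀ a b, G.adj a b ↔ H.adj a b
  collider_iff : ∀ i j k, i ≠ k → (G.hasColliderWithOrder i j k ↔ H.hasColliderWithOrder i j k)

lemma SameOrderedColliders.symm (h : SameOrderedColliders G H) : SameOrderedColliders H G :=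
  ⟨fun a b => (h.adj_iff a b).symm, fun i j k hik => (h.collider_iff i j k hik).symm⟩

/-- `⟨w 0, …, w (m + 2)⟩` is a discriminating path for its last triple, up to the condition that
`w (m + 1)` and `w (m + 2)` be adjacent. -/
structure IsDiscriminating (G : MixedGraph V) (m : ℕ) (w : ℕ → V) : Prop where
  one_le : 1 ≤ m
  not_adj : ¬ G.adj (w 0) (w (m + 2))
  dirEdge : ∀ l, 1 ≤ l → l ≤ m → G.dirEdge (w l) (w (m + 2))
  inj : ∀ l l', l ≤ m + 2 → l' ≤ m + 2 → w l = w l' → l = l'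
  collider : ∀ l, l + 2 ≤ m + 1 → G.hasColliderWithOrder (w l) (w (l + 1)) (w (l + 2))

lemma IsDiscriminating.discPathFor (h : IsDiscriminating G m w)
    (hw : (w m = i ∧ w (m + 1) = j ∧ w (m + 2) = k) ∨
      (w m = k ∧ w (m + 1) = j ∧ w (m + 2) = i)) :
    ∃ t, G.discPathFor (G.colliderOrderLE t) i j k := by
  choose! t ht using h.collider
  refine ⟨∑ l ∈ Finset.range m, t l, m, w, h.one_le, hw, h.not_adj, h.dirEdge, h.inj,
    fun l hl => (ht l hl).mono ?_⟩
  exact Finset.single_le_sum (f := t) (fun _ _ => Nat.zero_le _) (Finset.mem_range.2 (by omega))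

lemma IsDiscriminating.hasColliderWithOrder (h : IsDiscriminating G m w)
    (hc : G.isCollider (w m) (w (m + 1)) (w (m + 2))) :
    G.hasColliderWithOrder (w m) (w (m + 1)) (w (m + 2)) := by
  obtain ⟨t, ht⟩ := h.discPathFor (.inl ⟨rfl, rfl, rfl⟩)
  exact ⟨t + 1, .inr ⟨hc, ht⟩⟩

lemma IsDiscriminating.congr_graph (hG : G.IsAncestral) (hH : H.IsAncestral)
    (hE : SameOrderedColliders G H) (h : IsDiscriminating G m w) : IsDiscriminating H m w := by
  have hcol : ∀ l, l + 2 ≤ m + 1 → H.hasColliderWithOrder (w l) (w (l + 1)) (w (l + 2)) :=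
    fun l hl => (hE.collider_iff _ _ _ fun he => by
      have := h.inj _ _ (by omega) (by omega) he
      omega).1 (h.collider l hl)
  refine ⟨h.one_le, fun hadj => h.not_adj ((hE.adj_iff _ _).2 hadj), fun l => ?_, h.inj, hcol⟩
  induction l using Nat.strong_induction_on with
  | _ l ih =>
    intro hl hlm
    obtain ⟨l, rfl⟩ : ∃ l', l = l' + 1 := ⟨l - 1, by omega⟩
    obtain ⟨p, q, he⟩ := (hE.adj_iff _ _).1 ⟨_, _, h.dirEdge _ hl hlm⟩
    obtain ⟨m₁, -, h₁, -⟩ := (hcol l (by omega)).isCollider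
    cases p
    · exact hH.dirEdge_of_tail h₁ he
    exfalso
    have hc : H.isCollider (w l) (w (l + 1)) (w (m + 2)) := ⟨_, _, h₁, he⟩
    have hord : H.hasColliderWithOrder (w l) (w (l + 1)) (w (m + 2)) := by
      rcases Nat.eq_zero_or_pos l with rfl | hl0
      · exact ⟨0, hc, fun hadj => h.not_adj ((hE.adj_iff _ _).2 hadj)⟩
      · have hdisc : IsDiscriminating H l fun i => if i ≤ l + 1 then w i else w (m + 2) := by
          refine ⟨hl0, ?_, fun i hi hil => ?_, fun i i' hi hi' hii => ?_, fun i hi => ?_⟩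
          · simpa using fun hadj => h.not_adj ((hE.adj_iff _ _).2 hadj)
          · simpa [show i ≤ l + 1 by omega] using ih i (by omega) hi (by omega)
          · split_ifs at hii
            · exact h.inj _ _ (by omega) (by omega) hii
            · have := h.inj _ _ (by omega) (by omega) hii
              omega
            · have := h.inj _ _ (by omega) (by omega) hii
              omega
            · omega
          · simpa [show i ≤ l + 1 by omega, show i ≤ l by omega, show i + 2 ≤ l + 1 by omega,
              show i + 1 ≤ l by omega] using hcol i (by omega)
        simpa using hdisc.hasColliderWithOrder (by simpa using hc)
    have := ((hE.collider_iff _ _ _ fun he => by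
      have := h.inj _ _ (by omega) (by omega) he
      omega).2 hord).isCollider
    have := hG.edge_arrow_of_isCollider_right this (h.dirEdge _ hl hlm)
    cases this

/-- `⟨a, b, c⟩` is unshielded or at the end of a discriminating path. -/
def OrderedTriple (G : MixedGraph V) (a b c : V) : Prop :=
  ¬ G.adj a c ∨ ∃ m w, IsDiscriminating G m w ∧
    ((w m = a ∧ w (m + 1) = b ∧ w (m + 2) = c) ∨ (w m = c ∧ w (m + 1) = b ∧ w (m + 2) = a))

lemma OrderedTriple.symm (hG : G.IsAncestral) (h : OrderedTriple G a b c) :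
    OrderedTriple G c b a := by
  rcases h with h | ⟨m, w, h, hw⟩
  · exact .inl fun hadj => h (hG.adj_symm hadj)
  · exact .inr ⟨m, w, h, hw.symm⟩

lemma OrderedTriple.hasColliderWithOrder (h : OrderedTriple G a b c) (hc : G.isCollider a b c) :
    G.hasColliderWithOrder a b c := by
  rcases h with h | ⟨m, w, h, hw⟩
  · exact ⟨0, hc, h⟩
  · obtain ⟨t, ht⟩ := h.discPathFor hw
    exact ⟨t + 1, .inr ⟨hc, ht⟩⟩

lemma OrderedTriple.congr_graph (hG : G.IsAncestral) (hH : H.IsAncestral)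
    (hE : SameOrderedColliders G H) (h : OrderedTriple G a b c) : OrderedTriple H a b c := by
  rcases h with h | ⟨m, w, h, hw⟩
  · exact .inl fun hadj => h ((hE.adj_iff _ _).2 hadj)
  · exact .inr ⟨m, w, h.congr_graph hG hH hE, hw⟩

lemma OrderedTriple.isCollider_iff (hG : G.IsAncestral) (hH : H.IsAncestral)
    (hE : SameOrderedColliders G H) (hac : a ≠ c) (h : OrderedTriple G a b c) :
    G.isCollider a b c ↔ H.isCollider a b c :=
  ⟨fun hc => ((hE.collider_iff _ _ _ hac).1 (h.hasColliderWithOrder hc)).isCollider,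
    fun hc => ((hE.collider_iff _ _ _ hac).2
      ((h.congr_graph hG hH hE).hasColliderWithOrder hc)).isCollider⟩

end Order

/-! ### Triples of shortest connecting walks -/

namespace MWalk

variable {C : Set V} {d : V → ℕ} {w : MWalk G} {i j k l : ℕ}

lemma IsShortest.reverse (hG : G.IsAncestral) (hw : w.IsShortest C d) :
    (w.reverse hG).IsShortest C d := by
  have hlen : (w.reverse hG).len = w.len := rfl
  have h0 : (w.reverse hG).vtx 0 = w.vtx w.len := by simp [MWalk.reverse]
  have h1 : (w.reverse hG).vtx (w.reverse hG).len = w.vtx 0 := by simp [MWalk.reverse]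
  refine ⟨fun i hi => ?_, fun m n s h => ?_⟩
  · rw [PassesAt, inMark_reverse hG w hi, outMark_reverse hG w hi]
    exact (hw.passes (w.len - i) (by omega)).symm
  · rw [h0, h1] at h
    have h00 := (hw.passes 0 (Nat.zero_le _)).notMem_zero
    obtain ⟨k, hk⟩ := (Reaches.nil (G := G) (C := C) (S := G.ancSet C) (d := d)
      (x := w.vtx 0)).join hG h (passes_none h00)
    have := hw.le_of_reaches _ _ _ hk
    rw [zero_add, zero_add] at this
    refine ⟨this.1, fun hn => ?_⟩
    have hs := this.2 hn
    simp only [colliderCost, reduceCtorEq, false_and, if_false, add_zero] at hs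
    refine le_trans (le_of_eq ?_) hs
    rw [hlen, ← Finset.sum_range_reflect]
    refine Finset.sum_congr rfl fun i hi => ?_
    have hi := Finset.mem_range.1 hi
    rw [cost, inMark_reverse hG w (by omega), outMark_reverse hG w (by omega), colliderCost_symm,
      cost]
    simp only [MWalk.reverse]
    rw [show w.len - (w.len + 1 - 1 - i) = i by omega]

lemma colliderAt_of_mem (hp : w.PassesAt C (G.ancSet C) i) (hi : w.vtx i ∈ C) : w.colliderAt i := by
  rw [colliderAt_iff]
  by_contra hc
  exact hp.notMem hc hi

lemma mem_ancSet_of_colliderAt (hp : w.PassesAt C (G.ancSet C) i) (hi : w.colliderAt i) :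
    w.vtx i ∈ G.ancSet C := by
  rw [colliderAt_iff] at hi
  rw [PassesAt, hi.1, hi.2] at hp
  exact hp.mem

lemma colliderAt.inMark_eq (h : w.colliderAt i) : w.inMark i = some .arrow :=
  (w.colliderAt_iff.1 h).1

lemma colliderAt.edge_pred (h : w.colliderAt i) :
    G.edge (w.vtx (i - 1)) (w.vtx i) (w.mk₁ (i - 1)) .arrow := by
  have := w.isEdge (i - 1) (by have := h.2.1; omega)
  rwa [show i - 1 + 1 = i by have := h.1; omega, h.2.2.1] at this

lemma colliderAt.edge_succ (h : w.colliderAt i) :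
    G.edge (w.vtx i) (w.vtx (i + 1)) .arrow (w.mk₂ i) := by
  have := w.isEdge i h.2.1
  rwa [h.2.2.2] at this

lemma colliderAt.isCollider (h : w.colliderAt i) :
    G.isCollider (w.vtx (i - 1)) (w.vtx i) (w.vtx (i + 1)) :=
  ⟨_, _, h.edge_pred, h.edge_succ⟩

lemma colliderAt_iff_isCollider (hG : G.Simple) (h0 : 0 < i) (hi : i < w.len) :
    w.colliderAt i ↔ G.isCollider (w.vtx (i - 1)) (w.vtx i) (w.vtx (i + 1)) := by
  refine ⟨fun h => h.isCollider, fun h => ⟨h0, hi, ?_, ?_⟩⟩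
  · have := w.isEdge (i - 1) (by omega)
    rw [show i - 1 + 1 = i by omega] at this
    obtain ⟨_, _, h, -⟩ := h
    exact (hG _ _ _ _ _ _ this h).2
  · obtain ⟨_, _, -, h⟩ := h
    exact (hG _ _ _ _ _ _ (w.isEdge i hi) h).1

/-- A shortest connecting walk has no shortcut. -/
lemma IsShortest.not_shortcut (hG : G.IsAncestral) (hw : w.IsShortest C d) (hjk : j + 1 < k)
    (hk : k ≤ w.len) {p q : Mark} (he : G.edge (w.vtx j) (w.vtx k) p q)
    (hj : Passes C (G.ancSet C) (w.vtx j) (w.inMark j) (some p)) :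
    ¬ Passes C (G.ancSet C) (w.vtx k) (some q) (w.outMark k) := by
  intro hkp
  have h₁ := (w.reaches_take (d := d) (fun t ht => hw.passes t ht.le)
    (show j ≤ w.len by omega)).step he hj
  obtain ⟨s, h₂, -⟩ := w.reaches_drop hG (d := d) (fun t _ ht => hw.passes t ht) hk
  obtain ⟨r, h₃⟩ := h₁.join hG h₂ hkp
  have := (hw.le_of_reaches _ _ _ h₃).1
  omega

/-- Walking back from position `i` along parents of `c` until reaching a vertex nonadjacent
to `c`. -/
lemma IsShortest.exists_nonadj (hG : G.IsAncestral) (hw : w.IsShortest C d) (hi0 : 0 < i)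
    (hi : i ≤ w.len) {c : V}
    (hbase : ∀ p q, G.edge (w.vtx (i - 1)) c p q → q = .arrow)
    (hanc : w.mk₁ (i - 1) = .tail → w.vtx (i - 1) ∈ G.ancSet C ∨ G.ancestor (w.vtx (i - 1)) c)
    (hno : ∀ j < i, ∀ p, G.edge (w.vtx j) c p .arrow →
      ¬ Passes C (G.ancSet C) (w.vtx j) (w.inMark j) (some p)) :
    ∃ k < i, ¬ G.adj (w.vtx k) c ∧
      ∀ j, k < j → j < i → w.colliderAt j ∧ G.dirEdge (w.vtx j) c := by
  have key : ∀ n k, k + 1 + n = i →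
      (∀ j, k < j → j < i → w.colliderAt j ∧ G.dirEdge (w.vtx j) c) →
      (∃ k < i, ¬ G.adj (w.vtx k) c ∧
        ∀ j, k < j → j < i → w.colliderAt j ∧ G.dirEdge (w.vtx j) c) ∨
      w.colliderAt k ∧ G.dirEdge (w.vtx k) c := by
    intro n k hk hcol
    by_cases hadj : G.adj (w.vtx k) c
    swap
    · exact .inl ⟨k, by omega, hadj, hcol⟩
    right
    obtain ⟨p, q, he⟩ := hadj
    have htail : w.mk₁ k = .tail → w.vtx k ∈ G.ancSet C ∨ G.ancestor (w.vtx k) c := by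
      intro ht
      rcases Nat.eq_zero_or_pos n with rfl | hn
      · obtain rfl : k = i - 1 := by omega
        exact hanc ht
      · obtain ⟨h₁, h₂⟩ := hcol (k + 1) (by omega) (by omega)
        have := h₁.edge_pred
        simp only [Nat.add_sub_cancel, ht] at this
        exact .inr (.tail (.single this) h₂)
    obtain rfl : q = .arrow := by
      rcases Nat.eq_zero_or_pos n with rfl | hn
      · obtain rfl : k = i - 1 := by omega
        exact hbase _ _ he
      · obtain ⟨h₁, h₂⟩ := hcol (k + 1) (by omega) (by omega)
        exact hG.eq_arrow_of_transGen h₁.edge_pred (.single h₂) he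
    have hnp := hno k (by omega) p he
    have hp := hw.passes k (by omega)
    by_cases hC : w.vtx k ∈ C
    · have hc := colliderAt_of_mem hp hC
      refine ⟨hc, ?_⟩
      cases p
      · exact he
      · exact (hnp (.inl ⟨hc.inMark_eq, rfl, subset_ancSet hC⟩)).elim
    · exfalso
      by_cases hm : w.inMark k = some .arrow ∧ some p = some Mark.arrow
      · obtain ⟨hin, hpa⟩ := hm
        cases hpa
        have hnS : w.vtx k ∉ G.ancSet C := fun hS => hnp (.inl ⟨hin, rfl, hS⟩)
        cases hmk : w.mk₁ k
        · rcases htail hmk with h | h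
          · exact hnS h
          · exact hG.not_ancestor_of_arrow (hG.symm he) h
        · refine hnS (mem_ancSet_of_colliderAt hp ?_)
          rw [colliderAt_iff, outMark_of_lt _ (by omega), hmk]
          exact ⟨hin, rfl⟩
      · exact hnp (passes_of_notMem hC hm)
  have step : ∀ n ≤ i, (∃ k < i, ¬ G.adj (w.vtx k) c ∧
      ∀ j, k < j → j < i → w.colliderAt j ∧ G.dirEdge (w.vtx j) c) ∨
      ∀ j, i ≤ j + n → j < i → w.colliderAt j ∧ G.dirEdge (w.vtx j) c := by
    intro n hn
    induction n with
    | zero => exact .inr fun j _ _ => by omega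
    | succ n ih =>
      rcases ih (by omega) with h | h
      · exact .inl h
      rcases key n (i - 1 - n) (by omega) (fun j _ _ => h j (by omega) (by omega)) with h' | h'
      · exact .inl h'
      · refine .inr fun j hj hji => ?_
        by_cases hj' : i ≤ j + n
        · exact h j hj' hji
        · rwa [show j = i - 1 - n by omega]
  rcases step i le_rfl with h | h
  · exact h
  · exact absurd (h 0 (by omega) hi0).1.1 (lt_irrefl 0)

/-- The triple at position `i` is, up to the conditions on orders, at the end of a discriminating
path along the preceding part of the walk. -/
def LeftShielded (w : MWalk G) (i : ℕ) : Prop :=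
  ∃ k, k + 1 < i ∧ ¬ G.adj (w.vtx k) (w.vtx (i + 1)) ∧
    ∀ j, k < j → j < i → w.colliderAt j ∧ G.dirEdge (w.vtx j) (w.vtx (i + 1))

/-- The triple at position `i` is, up to the conditions on orders, at the end of a discriminating
path along the reverse of the following part of the walk. -/
def RightShielded (w : MWalk G) (i : ℕ) : Prop :=
  ∃ l, i + 1 < l ∧ l ≤ w.len ∧ ¬ G.adj (w.vtx l) (w.vtx (i - 1)) ∧
    ∀ j, i < j → j < l → w.colliderAt j ∧ G.dirEdge (w.vtx j) (w.vtx (i - 1))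

lemma IsShortest.leftShielded (hG : G.IsAncestral) (hw : w.IsShortest C d) (hi0 : 0 < i)
    (hi : i < w.len) {p q : Mark} (he : G.edge (w.vtx (i - 1)) (w.vtx (i + 1)) p q)
    (hnp : ¬ Passes C (G.ancSet C) (w.vtx (i - 1)) (w.inMark (i - 1)) (some p)) :
    w.LeftShielded i := by
  have hp := hw.passes (i - 1) (by omega)
  have hei := w.isEdge (i - 1) (by omega)
  rw [show i - 1 + 1 = i by omega] at hei
  by_cases hC : w.vtx (i - 1) ∈ C
  swap
  · exfalso
    by_cases hm : w.inMark (i - 1) = some .arrow ∧ some p = some Mark.arrow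
    swap
    · exact hnp (passes_of_notMem hC hm)
    obtain ⟨hin, hpa⟩ := hm
    cases hpa
    have hnS : w.vtx (i - 1) ∉ G.ancSet C := fun hS => hnp (.inl ⟨hin, rfl, hS⟩)
    cases hmk : w.mk₁ (i - 1)
    swap
    · refine hnS (mem_ancSet_of_colliderAt hp ?_)
      rw [colliderAt_iff, outMark_of_lt _ (by omega), hmk]
      exact ⟨hin, rfl⟩
    rw [hmk] at hei
    obtain ⟨a, m, ha⟩ := exists_edge_of_inMark hin (by omega)
    have hdir := hG.dirEdge_of_tail ha hei
    have hmk₂ : w.mk₂ (i - 1) = .arrow := hG.eq_arrow_of_tail ha hei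
    have hnot : ¬ w.colliderAt i := fun hc => by
      obtain ⟨c, hc, hic⟩ := mem_ancSet_of_colliderAt (hw.passes i hi.le) hc
      exact hnS ⟨c, hc, .head hdir hic⟩
    have hei' := w.isEdge i hi
    cases hmk' : w.mk₁ i
    · rw [hmk'] at hei'
      have := hG.dirEdge_of_tail hdir hei'
      exact hG.not_ancestor_of_arrow (hG.symm he) (.head hdir (.single this))
    · exact hnot ⟨hi0, hi, hmk₂, hmk'⟩
  have hc := colliderAt_of_mem hp hC
  have hmk : w.mk₁ (i - 1) = .arrow := hc.2.2.2
  rw [hmk] at hei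
  obtain ⟨rfl, rfl⟩ : p = .tail ∧ q = .arrow := by
    cases p
    · exact ⟨rfl, hG.eq_arrow_of_tail hc.edge_pred he⟩
    · exact (hnp (.inl ⟨hc.inMark_eq, rfl, subset_ancSet hC⟩)).elim
  have hmk₂ : w.mk₂ i = .arrow :=
    hG.eq_arrow_of_transGen (hG.symm hei) (.single he) (w.isEdge i hi)
  obtain ⟨k, hk, hnadj, hcol⟩ := hw.exists_nonadj hG hi0 hi.le (c := w.vtx (i + 1))
    (fun p q h => (hG.simple _ _ _ _ _ _ h he).2) (by simp [hmk]) fun j hj p hjp hjpass => by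
      refine hw.not_shortcut hG (by omega) hi hjp hjpass ?_
      have := hw.passes (i + 1) hi
      rwa [PassesAt, inMark_succ, hmk₂] at this
  refine ⟨k, ?_, hnadj, hcol⟩
  by_contra hlt
  obtain rfl : k = i - 1 := by omega
  exact hnadj ⟨_, _, he⟩

lemma IsShortest.rightShielded (hG : G.IsAncestral) (hw : w.IsShortest C d) (hi0 : 0 < i)
    (hi : i < w.len) {p q : Mark} (he : G.edge (w.vtx (i - 1)) (w.vtx (i + 1)) p q)
    (hnp : ¬ Passes C (G.ancSet C) (w.vtx (i + 1)) (some q) (w.outMark (i + 1))) :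
    w.RightShielded i := by
  have hv : ∀ j, (w.reverse hG).vtx j = w.vtx (w.len - j) := fun _ => rfl
  have h₁ : w.len - (w.len - i - 1) = i + 1 := by omega
  have h₂ : w.len - (w.len - i + 1) = i - 1 := by omega
  obtain ⟨k, hk, hnadj, hcol⟩ := (hw.reverse hG).leftShielded hG (i := w.len - i) (p := q) (q := p)
    (by omega) (show _ < w.len by omega) (by rw [hv, hv, h₁, h₂]; exact hG.symm he) (by
      rw [hv, inMark_reverse hG w (by omega), h₁]
      exact fun h => hnp h.symm)
  rw [hv, hv, h₂] at hnadj
  refine ⟨w.len - k, by omega, by omega, hnadj, fun j hj hjk => ?_⟩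
  obtain ⟨h₃, h₄⟩ := hcol (w.len - j) (by omega) (by omega)
  rw [hv, hv, h₂, show w.len - (w.len - j) = j by omega] at h₄
  refine ⟨?_, h₄⟩
  rw [colliderAt_iff] at h₃ ⊢
  rw [inMark_reverse hG w (by omega), outMark_reverse hG w (by omega),
    show w.len - (w.len - j) = j by omega] at h₃
  exact h₃.symm

lemma IsShortest.shielded_or (hG : G.IsAncestral) (hw : w.IsShortest C d) (hi0 : 0 < i)
    (hi : i < w.len) (hadj : G.adj (w.vtx (i - 1)) (w.vtx (i + 1))) :
    w.LeftShielded i ∨ w.RightShielded i := by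
  obtain ⟨p, q, he⟩ := hadj
  by_cases h : Passes C (G.ancSet C) (w.vtx (i - 1)) (w.inMark (i - 1)) (some p)
  · exact .inr (hw.rightShielded hG hi0 hi he (hw.not_shortcut hG (by omega) hi he h))
  · exact .inl (hw.leftShielded hG hi0 hi he h)

end MWalk

namespace MWalk

variable {C : Set V} {d : V → ℕ} {w : MWalk G} {i j k l m : ℕ}

/-- The segment of a walk from position `k` to position `k + n`. -/
def segment (w : MWalk G) (k n : ℕ) (h : k + n ≤ w.len) : MWalk G where
  len := n
  vtx i := w.vtx (k + i)
  mk₁ i := w.mk₁ (k + i)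
  mk₂ i := w.mk₂ (k + i)
  isEdge i hi := w.isEdge (k + i) (by omega)

lemma not_left_right (hG : G.IsAncestral) (hN : G.NoInducingWalk) (hw : w.IsPath)
    (hkj : k < j) (hji : j < i) (hil : i < l) (hl : l ≤ w.len)
    (hk : ¬ G.adj (w.vtx k) (w.vtx (i + 1)))
    (hkc : ∀ t, k < t → t < i → w.colliderAt t ∧ G.dirEdge (w.vtx t) (w.vtx (i + 1)))
    (hlk : ¬ G.adj (w.vtx l) (w.vtx (j - 1)))
    (hlc : ∀ t, j < t → t < l → w.colliderAt t ∧ G.dirEdge (w.vtx t) (w.vtx (j - 1))) : False := by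
  by_cases h₁ : k < j - 1
  · have h := (hkc (j - 1) h₁ (by omega)).2
    by_cases h₂ : i + 1 < l
    · have h' := (hlc (i + 1) (by omega) h₂).2
      exact hG.2.1 _ (.head h (.single h'))
    · obtain rfl : l = i + 1 := by omega
      exact hlk (hG.adj_symm ⟨_, _, h⟩)
  · obtain rfl : k = j - 1 := by omega
    by_cases h₂ : i + 1 < l
    · have h' := (hlc (i + 1) (by omega) h₂).2
      exact hk (hG.adj_symm ⟨_, _, h'⟩)
    · have h₃ : j - 1 + (i + 2 - j) = i + 1 := by omega
      refine hN _ _ (fun he => ?_) hk ⟨w.segment (j - 1) (i + 2 - j) (by omega), rfl, ?_,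
        fun t ht => ?_⟩
      · have := hw _ _ (by omega) (by omega) he
        omega
      · simp only [segment, h₃]
      · have ht : t + 1 < i + 2 - j := ht
        have hc : w.colliderAt (j - 1 + (t + 1)) := by
          by_cases hti : j - 1 + (t + 1) < i
          · exact (hkc _ (by omega) hti).1
          · exact (hlc _ (by omega) (by omega)).1
        refine ⟨hc.2.2.1, hc.2.2.2, ?_⟩
        by_cases hti : j - 1 + (t + 1) < i
        · exact .inr (.single (hkc _ (by omega) hti).2)
        · exact .inl (.single (hlc _ (by omega) (by omega)).2)

lemma orderedTriple_of_leftShielded (hw : w.IsPath) (hi : i < w.len) {c : V}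
    (hki : k + 1 < i) (hnadj : ¬ G.adj (w.vtx k) c)
    (hcol : ∀ j, k < j → j < i → w.colliderAt j ∧ G.dirEdge (w.vtx j) c)
    (hne : ∀ j, k ≤ j → j ≤ i → w.vtx j ≠ c)
    (hord : ∀ j, k < j → j < i → OrderedTriple G (w.vtx (j - 1)) (w.vtx j) (w.vtx (j + 1))) :
    OrderedTriple G (w.vtx (i - 1)) (w.vtx i) c := by
  refine .inr ⟨i - 1 - k, fun t => if k + t ≤ i then w.vtx (k + t) else c, ?_, .inl ?_⟩
  · have hlast : ¬ k + (i - 1 - k + 2) ≤ i := by omega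
    refine ⟨by omega, ?_, fun t ht hti => ?_, fun t t' ht ht' he => ?_, fun t ht => ?_⟩
    · simpa [hlast, show k ≤ i by omega] using hnadj
    · simpa [hlast, show k + t ≤ i by omega] using (hcol (k + t) (by omega) (by omega)).2
    · split_ifs at he
      · have := hw _ _ (by omega) (by omega) he
        omega
      · exact (hne _ (by omega) ‹_› he).elim
      · exact (hne _ (by omega) ‹_› he.symm).elim
      · omega
    · have h := (hord (k + t + 1) (by omega) (by omega)).hasColliderWithOrder
        (hcol (k + t + 1) (by omega) (by omega)).1.isCollider
      simpa [show k + t ≤ i by omega, show k + (t + 1) ≤ i by omega,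
        show k + (t + 2) ≤ i by omega, add_assoc] using h
  · simp [show k + (i - 1 - k) = i - 1 by omega, show k + (i - 1 - k + 1) = i by omega,
      show ¬ k + (i - 1 - k + 2) ≤ i by omega]

lemma colliderAt_reverse (hG : G.IsAncestral) (hi : i ≤ w.len) :
    (w.reverse hG).colliderAt i ↔ w.colliderAt (w.len - i) := by
  rw [colliderAt_iff, colliderAt_iff, inMark_reverse hG w hi, outMark_reverse hG w hi, and_comm]

lemma vtx_reverse (hG : G.IsAncestral) : (w.reverse hG).vtx i = w.vtx (w.len - i) := rfl

lemma orderedTriple_of_rightShielded (hG : G.IsAncestral) (hw : w.IsShortest C d) (hi0 : 0 < i)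
    (hi : i < w.len) (hil : i + 1 < l) (hl : l ≤ w.len)
    (hnadj : ¬ G.adj (w.vtx l) (w.vtx (i - 1)))
    (hcol : ∀ j, i < j → j < l → w.colliderAt j ∧ G.dirEdge (w.vtx j) (w.vtx (i - 1)))
    (hord : ∀ j, i < j → j < l → OrderedTriple G (w.vtx (j - 1)) (w.vtx j) (w.vtx (j + 1))) :
    OrderedTriple G (w.vtx (i - 1)) (w.vtx i) (w.vtx (i + 1)) := by
  have h := orderedTriple_of_leftShielded (w := w.reverse hG) (i := w.len - i) (k := w.len - l)
    (c := w.vtx (i - 1)) ((hw.reverse hG).isPath hG) (show _ < w.len by omega) (by omega) (by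
      rw [vtx_reverse, show w.len - (w.len - l) = l by omega]
      exact hnadj) (fun j hj hj' => by
      rw [colliderAt_reverse hG (by omega), vtx_reverse]
      exact hcol _ (by omega) (by omega)) (fun j hj hj' he => by
      rw [vtx_reverse] at he
      have := hw.isPath hG _ _ (by omega) (by omega) he
      omega) fun j hj hj' => by
      rw [vtx_reverse, vtx_reverse, vtx_reverse]
      have := (hord (w.len - j) (by omega) (by omega)).symm hG
      rwa [show w.len - j + 1 = w.len - (j - 1) by omega,
        show w.len - j - 1 = w.len - (j + 1) by omega] at this
  rw [vtx_reverse, vtx_reverse, show w.len - (w.len - i) = i by omega,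
    show w.len - (w.len - i - 1) = i + 1 by omega] at h
  exact h.symm hG

/-- All triples of a shortest connecting walk are unshielded or at the end of a discriminating
path. -/
lemma IsShortest.orderedTriple (hG : G.IsAncestral) (hN : G.NoInducingWalk)
    (hw : w.IsShortest C d) (hi0 : 0 < i) (hi : i < w.len) :
    OrderedTriple G (w.vtx (i - 1)) (w.vtx i) (w.vtx (i + 1)) := by
  classical
  have hpath := hw.isPath hG
  by_contra hcon
  set bad : ℕ → Prop := fun i => 0 < i ∧ i < w.len ∧
    ¬ OrderedTriple G (w.vtx (i - 1)) (w.vtx i) (w.vtx (i + 1)) with hbad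
  have hleft : ∀ i k, bad i → k + 1 < i → ¬ G.adj (w.vtx k) (w.vtx (i + 1)) →
      (∀ j, k < j → j < i → w.colliderAt j ∧ G.dirEdge (w.vtx j) (w.vtx (i + 1))) →
      ∃ j, bad j ∧ k < j ∧ j < i := by
    intro i k ⟨hi0, hi, hno⟩ hki hnadj hcol
    by_contra! hnone
    refine hno (orderedTriple_of_leftShielded hpath hi hki hnadj hcol (fun j hj hji he => ?_)
      fun j hkj hji => ?_)
    · have := hpath _ _ (by omega) (by omega) he
      omega
    · by_contra hj
      have := hnone j ⟨by omega, by omega, hj⟩ hkj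
      omega
  have hright : ∀ i l, bad i → i + 1 < l → l ≤ w.len → ¬ G.adj (w.vtx l) (w.vtx (i - 1)) →
      (∀ j, i < j → j < l → w.colliderAt j ∧ G.dirEdge (w.vtx j) (w.vtx (i - 1))) →
      ∃ j, bad j ∧ i < j ∧ j < l := by
    intro i l ⟨hi0, hi, hno⟩ hil hl hnadj hcol
    by_contra! hnone
    refine hno (orderedTriple_of_rightShielded hG hw hi0 hi hil hl hnadj hcol fun j hij hjl => ?_)
    by_contra hj
    have := hnone j ⟨by omega, by omega, hj⟩ hij
    omega
  have hshield : ∀ i, bad i → w.LeftShielded i ∨ w.RightShielded i := fun i hi =>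
    hw.shielded_or hG hi.1 hi.2.1 (by_contra fun h => hi.2.2 (.inl h))
  by_cases hL : ∃ i, bad i ∧ w.LeftShielded i
  · obtain ⟨hib, k, hki, hnadj, hcol⟩ := Nat.find_spec hL
    have hmin : ∀ j < Nat.find hL, bad j → ¬ w.LeftShielded j := fun j hj hb hs =>
      Nat.find_min hL hj ⟨hb, hs⟩
    set i := Nat.find hL
    obtain ⟨j₀, hj₀, hkj₀, hj₀i⟩ := hleft i k hib hki hnadj hcol
    set j := Nat.findGreatest (fun j => bad j ∧ k < j ∧ j < i) i with hj
    obtain ⟨hjb, hkj, hji⟩ : bad j ∧ k < j ∧ j < i :=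
      Nat.findGreatest_spec (P := fun j => bad j ∧ k < j ∧ j < i) hj₀i.le ⟨hj₀, hkj₀, hj₀i⟩
    rcases hshield j hjb with hs | ⟨l, hjl, hl, hlnadj, hlcol⟩
    · exact hmin j hji hjb hs
    obtain ⟨t, htb, hjt, htl⟩ := hright j l hjb hjl hl hlnadj hlcol
    by_cases hti : t < i
    · have := Nat.le_findGreatest (P := fun j => bad j ∧ k < j ∧ j < i) hti.le
        ⟨htb, by omega, hti⟩
      omega
    · exact not_left_right hG hN hpath hkj hji (by omega) hl hnadj hcol hlnadj hlcol
  · have hR : ∀ i, bad i → ∃ j, bad j ∧ i < j := fun i hi => by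
      rcases hshield i hi with hs | ⟨l, hil, hl, hlnadj, hlcol⟩
      · exact (hL ⟨i, hi, hs⟩).elim
      · obtain ⟨j, hj, hij, -⟩ := hright i l hi hil hl hlnadj hlcol
        exact ⟨j, hj, hij⟩
    have hspec : bad (Nat.findGreatest bad w.len) := Nat.findGreatest_spec hi.le ⟨hi0, hi, hcon⟩
    obtain ⟨j, hj, hlt⟩ := hR _ hspec
    have := Nat.le_findGreatest hj.2.1.le hj
    omega

end MWalk

/-! ### Distances to the conditioning set -/

/-- There is a directed walk with `n` edges from `v` to `C`. -/
def AncestorWithin (G : MixedGraph V) (C : Set V) : ℕ → V → Prop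
  | 0, v => v ∈ C
  | n + 1, v => ∃ u, G.dirEdge v u ∧ AncestorWithin G C n u

/-- The length of a shortest directed walk from `v` to `C`. -/
noncomputable def distTo (G : MixedGraph V) (C : Set V) (v : V) : ℕ :=
  sInf {n | AncestorWithin G C n v}

section Distance

variable {C : Set V} {u v : V} {n : ℕ}

lemma AncestorWithin.mem_ancSet (h : AncestorWithin G C n v) : v ∈ G.ancSet C := by
  induction n generalizing v with
  | zero => exact subset_ancSet h
  | succ n ih =>
    obtain ⟨u, hvu, hu⟩ := h
    obtain ⟨c, hc, huc⟩ := ih hu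
    exact ⟨c, hc, .head hvu huc⟩

lemma exists_ancestorWithin (h : v ∈ G.ancSet C) : ∃ n, AncestorWithin G C n v := by
  obtain ⟨c, hc, hvc⟩ := h
  induction hvc using ReflTransGen.head_induction_on with
  | refl => exact ⟨0, hc⟩
  | head hvu _ ih =>
    obtain ⟨n, hn⟩ := ih
    exact ⟨n + 1, _, hvu, hn⟩

lemma ancestorWithin_distTo (h : v ∈ G.ancSet C) : AncestorWithin G C (G.distTo C v) v :=
  Nat.sInf_mem (exists_ancestorWithin h)

lemma distTo_le_succ (hvu : G.dirEdge v u) (hu : u ∈ G.ancSet C) :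
    G.distTo C v ≤ G.distTo C u + 1 :=
  Nat.sInf_le ⟨u, hvu, ancestorWithin_distTo hu⟩

lemma exists_dirEdge_distTo (hv : v ∈ G.ancSet C) (hvC : v ∉ C) :
    ∃ u, G.dirEdge v u ∧ u ∈ G.ancSet C ∧ G.distTo C v = G.distTo C u + 1 := by
  have h := ancestorWithin_distTo hv
  rcases hn : G.distTo C v with - | n
  · rw [hn] at h
    exact (hvC h).elim
  · rw [hn] at h
    obtain ⟨u, hvu, hu⟩ := h
    have h₁ := distTo_le_succ hvu hu.mem_ancSet
    have h₂ : G.distTo C u ≤ n := Nat.sInf_le hu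
    exact ⟨u, hvu, hu.mem_ancSet, by omega⟩

lemma mem_ancSet_of_distTo (hG : G.IsAncestral) (hH : H.IsAncestral)
    (hE : SameOrderedColliders G H) (hvu : G.dirEdge v u) (hvu' : H.dirEdge v u)
    (hu : u ∈ G.ancSet C) (hd : G.distTo C v = G.distTo C u + 1) : u ∈ H.ancSet C := by
  induction hn : G.distTo C u generalizing u v with
  | zero =>
    have := ancestorWithin_distTo hu
    rw [hn] at this
    exact subset_ancSet this
  | succ n ih =>
    by_cases huC : u ∈ C
    · exact subset_ancSet huC
    obtain ⟨x, hux, hx, hdx⟩ := exists_dirEdge_distTo hu huC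
    have hvx : v ≠ x := by
      rintro rfl
      exact hG.2.1 _ (.head hvu (.single hux))
    have hnadj : ¬ G.adj v x := by
      rintro ⟨p, q, he⟩
      obtain ⟨rfl, rfl⟩ := hG.dirEdge_of_transGen he (.head hvu (.single hux))
      have := distTo_le_succ he hx
      omega
    obtain ⟨p, q, he⟩ := (hE.adj_iff _ _).1 ⟨_, _, hux⟩
    have hux' : H.dirEdge u x := by
      cases p
      · exact hH.dirEdge_of_tail hvu' he
      · have hc := ((hE.collider_iff _ _ _ hvx).2
          ⟨0, ⟨_, _, hvu', he⟩, fun h => hnadj ((hE.adj_iff _ _).2 h)⟩).isCollider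
        have := hG.edge_arrow_of_isCollider_right hc hux
        cases this
    obtain ⟨c, hc, hxc⟩ := ih hux hux' hx (by omega) (by omega)
    exact ⟨c, hc, .head hux' hxc⟩

end Distance

namespace MWalk

variable {C : Set V} {w : MWalk G} {i j k l m : ℕ}

/-- If no vertex before a collider leads to the next vertex on a shortest directed walk to `C`,
then the collider and that vertex form an ordered triple with the preceding vertex. -/
lemma IsShortest.orderedTriple_of_not_passes (hG : G.IsAncestral) (hN : G.NoInducingWalk)
    {d : V → ℕ} (hw : w.IsShortest C d) (hc : w.colliderAt i) {c : V}
    (hic : G.dirEdge (w.vtx i) c)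
    (hno : ∀ j < i, ∀ p, G.edge (w.vtx j) c p .arrow →
      ¬ Passes C (G.ancSet C) (w.vtx j) (w.inMark j) (some p)) :
    w.vtx (i - 1) ≠ c ∧ OrderedTriple G (w.vtx (i - 1)) (w.vtx i) c := by
  have hne : w.vtx (i - 1) ≠ c := by
    rintro rfl
    exact hG.not_ancestor_of_arrow hc.edge_pred (.single hic)
  refine ⟨hne, ?_⟩
  have hi0 := hc.1
  have hi := hc.2.1
  obtain ⟨k, hki, hnadj, hcol⟩ := hw.exists_nonadj hG hc.1 hi.le (c := c)
    (fun p q he => hG.eq_arrow_of_transGen hc.edge_pred (.single hic) he) (fun ht => by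
      have := hc.edge_pred
      rw [ht] at this
      exact .inr (.head this (.single hic))) hno
  by_cases hk : k + 1 < i
  · refine orderedTriple_of_leftShielded (hw.isPath hG) hi hk hnadj hcol (fun j hkj hji he => ?_)
      fun j hkj hji => hw.orderedTriple hG hN (by omega) (by omega)
    rcases hkj.eq_or_lt with rfl | hkj
    · obtain ⟨h₁, h₂⟩ := hcol (k + 1) (by omega) hk
      rw [← he] at h₂
      exact hG.not_ancestor_of_arrow h₁.edge_pred (.single h₂)
    · rcases hji.eq_or_lt with rfl | hji
      · rw [he] at hic
        exact hG.1.2 _ _ _ hic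
      · have := (hcol j hkj hji).2
        rw [he] at this
        exact hG.1.2 _ _ _ this
  · obtain rfl : k = i - 1 := by omega
    exact .inl hnadj

lemma IsShortest.not_passes_left_or_right (hG : G.IsAncestral)
    (hw : w.IsShortest C (G.distTo C)) (hc : w.colliderAt i) {c : V}
    (hic : G.dirEdge (w.vtx i) c) (hcC : c ∈ G.ancSet C)
    (hd : G.distTo C (w.vtx i) = G.distTo C c + 1) :
    (∀ j < i, ∀ p, G.edge (w.vtx j) c p .arrow →
      ¬ Passes C (G.ancSet C) (w.vtx j) (w.inMark j) (some p)) ∨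
    (∀ l, i < l → l ≤ w.len → ∀ q, G.edge (w.vtx l) c q .arrow →
      ¬ Passes C (G.ancSet C) (w.vtx l) (some q) (w.outMark l)) := by
  by_contra! hcon
  obtain ⟨⟨j, hji, p, hjc, hj⟩, l, hil, hl, q, hlc, hlp⟩ := hcon
  have h₁ := (w.reaches_take (d := G.distTo C) (fun t ht => hw.passes t ht.le)
    (show j ≤ w.len by omega)).step hjc hj
  obtain ⟨s, h₂, hs⟩ := w.reaches_drop hG (d := G.distTo C) (fun t _ ht => hw.passes t ht) hl
  obtain ⟨r, h₃⟩ := h₁.join hG (h₂.step hlc hlp.symm) (.inl ⟨rfl, rfl, hcC⟩)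
  obtain ⟨hlen, hcost⟩ := hw.le_of_reaches _ _ _ h₃
  obtain rfl : l = i + 1 := by omega
  obtain rfl : i = j + 1 := by omega
  have hcost := hcost (by omega)
  have hpred := hc.edge_pred
  simp only [Nat.add_sub_cancel] at hpred
  have hcj : colliderCost (G.distTo C) (w.vtx j) (w.inMark j) (some p) ≤
      w.cost (G.distTo C) j := by
    rw [cost, w.outMark_of_lt (by omega)]
    cases hmk : w.mk₁ j
    · rw [hmk] at hpred
      obtain ⟨rfl, -⟩ := hG.dirEdge_of_transGen hjc (.head hpred (.single hic))
      exact le_rfl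
    · simp only [colliderCost]
      split_ifs <;> simp_all
  have hcl : colliderCost (G.distTo C) (w.vtx (j + 1 + 1)) (w.outMark (j + 1 + 1)) (some q) ≤
      w.cost (G.distTo C) (j + 1 + 1) := by
    have hsucc := hc.edge_succ
    rw [colliderCost_symm, cost, inMark_succ]
    cases hmk : w.mk₂ (j + 1)
    · rw [hmk] at hsucc
      obtain ⟨rfl, -⟩ := hG.dirEdge_of_transGen hlc
        (.head (hG.symm hsucc) (.single hic))
      exact le_rfl
    · simp only [colliderCost]
      split_ifs <;> simp_all
  have hci : w.cost (G.distTo C) (j + 1) = G.distTo C (w.vtx (j + 1)) := by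
    have := w.colliderAt_iff.1 hc
    rw [cost, colliderCost, if_pos this]
  rw [Finset.sum_range_succ, Finset.sum_range_succ, hci, hd] at hs
  simp only [colliderCost, and_self, if_true] at hcost hcj hcl
  omega

lemma IsShortest.mem_ancSet_of_colliderAt (hG : G.IsAncestral) (hN : G.NoInducingWalk)
    (hH : H.IsAncestral) (hE : SameOrderedColliders G H)
    (hw : w.IsShortest C (G.distTo C)) (hc : w.colliderAt i) : w.vtx i ∈ H.ancSet C := by
  by_cases hiC : w.vtx i ∈ C
  · exact subset_ancSet hiC
  have hi0 := hc.1
  have hi := hc.2.1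
  obtain ⟨c, hic, hcC, hd⟩ :=
    exists_dirEdge_distTo (MWalk.mem_ancSet_of_colliderAt (hw.passes i hi.le) hc) hiC
  suffices hdir : H.dirEdge (w.vtx i) c by
    obtain ⟨x, hx, hcx⟩ := mem_ancSet_of_distTo hG hH hE hic hdir hcC hd
    exact ⟨x, hx, .head hdir hcx⟩
  have hne : w.vtx (i - 1) ≠ w.vtx (i + 1) := fun he => by
    have := hw.isPath hG _ _ (by omega) (by omega) he
    omega
  obtain ⟨m₁, m₂, hH₁, hH₂⟩ := ((hw.orderedTriple hG hN hi0 hi).isCollider_iff hG hH hE hne).1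
    hc.isCollider
  obtain ⟨p, q, he⟩ := (hE.adj_iff _ _).1 ⟨_, _, hic⟩
  cases p
  · exact hH.dirEdge_of_tail hH₁ he
  exfalso
  have notc : ∀ a, ¬ G.isCollider a (w.vtx i) c := fun a h => by
    have := hG.edge_arrow_of_isCollider_right h hic
    cases this
  rcases hw.not_passes_left_or_right hG hc hic hcC hd with h | h
  · obtain ⟨hne, hord⟩ := hw.orderedTriple_of_not_passes hG hN hc hic h
    exact notc _ ((hord.isCollider_iff hG hH hE hne).2 ⟨_, _, hH₁, he⟩)
  · have hvi : (w.reverse hG).vtx (w.len - i) = w.vtx i := by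
      rw [vtx_reverse, show w.len - (w.len - i) = i by omega]
    obtain ⟨hne, hord⟩ := (hw.reverse hG).orderedTriple_of_not_passes hG hN (i := w.len - i)
      (c := c) (by
        rw [colliderAt_reverse hG (by omega), show w.len - (w.len - i) = i by omega]
        exact hc) (by rwa [hvi]) (fun j hj p hjc hjp => by
        rw [inMark_reverse hG w (by omega)] at hjp
        exact h (w.len - j) (by omega) (by omega) p hjc hjp.symm)
    rw [hvi, vtx_reverse, show w.len - (w.len - i - 1) = i + 1 by omega] at hord
    rw [vtx_reverse, show w.len - (w.len - i - 1) = i + 1 by omega] at hne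
    exact notc _ ((hord.isCollider_iff hG hH hE hne).2 ⟨_, _, hH.symm hH₂, he⟩)

/-- A connecting path transfers to a graph with the same adjacencies and colliders along it. -/
lemma mConnected_of_isCollider_iff (hG : G.Simple) (hH : H.Simple) (hpath : w.IsPath)
    (hw : ∀ i ≤ w.len, w.PassesAt C (G.ancSet C) i)
    (hadj : ∀ i < w.len, H.adj (w.vtx i) (w.vtx (i + 1)))
    (hcol : ∀ i, 0 < i → i < w.len →
      (G.isCollider (w.vtx (i - 1)) (w.vtx i) (w.vtx (i + 1)) ↔
        H.isCollider (w.vtx (i - 1)) (w.vtx i) (w.vtx (i + 1))))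
    (hanc : ∀ i, w.colliderAt i → w.vtx i ∈ H.ancSet C) :
    H.mConnected (w.vtx 0) (w.vtx w.len) C := by
  have : Nonempty Mark := ⟨.tail⟩
  choose! p q he using hadj
  set w' : MWalk H := ⟨w.len, w.vtx, p, q, he⟩ with hw'
  have hiff : ∀ i, w'.colliderAt i ↔ w.colliderAt i := fun i => by
    by_cases h : 0 < i ∧ i < w.len
    · rw [colliderAt_iff_isCollider hG h.1 h.2, colliderAt_iff_isCollider hH h.1 h.2]
      exact (hcol i h.1 h.2).symm
    · exact ⟨fun h' => (h ⟨h'.1, h'.2.1⟩).elim, fun h' => (h ⟨h'.1, h'.2.1⟩).elim⟩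
  refine ⟨w', hpath, rfl, rfl, fun i hi => hanc i ((hiff i).1 hi), fun i hi hnc => ?_⟩
  exact (w.mConnecting_iff.2 hw).2 i hi fun h => hnc ((hiff i).2 h)

end MWalk

lemma SameOrderedColliders.mConnected (hG : G.IsAncestral) (hN : G.NoInducingWalk)
    (hH : H.IsAncestral) (hE : SameOrderedColliders G H) {a b : V} {C : Set V}
    (h : G.mConnected a b C) : H.mConnected a b C := by
  obtain ⟨-, hb, m, h⟩ := h.exists_joins
  obtain ⟨w, hw, rfl, rfl⟩ := h.exists_isShortest hb (G.distTo C)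
  refine w.mConnected_of_isCollider_iff hG.simple hH.simple (hw.isPath hG) hw.passes
    (fun i hi => (hE.adj_iff _ _).1 ⟨_, _, w.isEdge i hi⟩) (fun i hi0 hi => ?_)
    fun i hi => hw.mem_ancSet_of_colliderAt hG hN hH hE hi
  refine (hw.orderedTriple hG hN hi0 hi).isCollider_iff hG hH hE fun he => ?_
  have := hw.isPath hG _ _ (by omega) (by omega) he
  omega

/-- Graphs without inducing walks that have the same adjacencies and colliders with order are
Markov equivalent. -/
theorem SameOrderedColliders.markovEquiv (hG : G.IsAncestral) (hGN : G.NoInducingWalk)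
    (hH : H.IsAncestral) (hHN : H.NoInducingWalk) (hE : SameOrderedColliders G H) :
    MarkovEquiv G H :=
  markovEquiv_iff.2 fun _ _ _ _ =>
    ⟨hE.mConnected hG hGN hH, hE.symm.mConnected hH hHN hG⟩

/-! ### Markov equivalent graphs have the same colliders with order -/

section Necessity

variable {a b i j k : V} {C : Set V} {m n t : ℕ} {w : ℕ → V}

lemma MarkovEquiv.symm (h : MarkovEquiv G H) : MarkovEquiv H G := fun A B C => (h A B C).symm

lemma MarkovEquiv.trans (h : MarkovEquiv G H) (h' : MarkovEquiv H K) : MarkovEquiv G K :=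
  fun A B C => (h A B C).trans (h' A B C)

lemma notMem_separator_left : a ∉ G.separator a b := fun h => h.2.1 rfl

lemma notMem_separator_right : b ∉ G.separator a b := fun h => h.2.2 rfl

lemma MarkovEquiv.adj (hG : G.IsAncestral) (hH : H.IsAncestral) (hHN : H.NoInducingWalk)
    (h : MarkovEquiv G H) (hab : G.adj a b) : H.adj a b := by
  obtain ⟨p, q, he⟩ := hab
  by_contra hn
  refine hHN.not_mConnected_separator hH (hG.ne he) hn ?_
  rw [← markovEquiv_iff.1 h _ _ _ (hG.ne he)]
  exact mConnected_of_edge hG he notMem_separator_left notMem_separator_right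

lemma IsAncestral.joins_of_isCollider (hG : G.IsAncestral) (h0 : w 0 ∉ C)
    (hC : ∀ l, 1 ≤ l → l ≤ n → w l ∈ C)
    (hcol : ∀ l, l + 2 ≤ n + 1 → G.isCollider (w l) (w (l + 1)) (w (l + 2))) {x : V} {p q : Mark}
    (he : G.edge (w n) x p q) (hp : 1 ≤ n → p = .arrow) :
    G.Joins C (G.ancSet C) (w 0) x (some q) := by
  induction n generalizing x p q with
  | zero => exact Joins.nil.step he (passes_none h0)
  | succ n ih =>
    obtain ⟨m₁, -, h₁, -⟩ := hcol n le_rfl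
    refine (ih (fun l hl hln => hC l hl (by omega)) (fun l hl => hcol l (by omega)) h₁
      fun hn => ?_).step he ?_
    · have := hcol (n - 1) (by omega)
      rw [show n - 1 + 1 = n by omega, show n - 1 + 2 = n + 1 by omega] at this
      exact hG.edge_arrow_of_isCollider_right this h₁
    · rw [hp (by omega)]
      exact .inl ⟨rfl, rfl, subset_ancSet (hC _ (by omega) le_rfl)⟩

lemma MarkovEquiv.dirEdge_and_isCollider (hG : G.IsAncestral) (hGN : G.NoInducingWalk)
    (hH : H.IsAncestral) (hHN : H.NoInducingWalk) (h : MarkovEquiv G H)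
    (h0 : w 0 ≠ w (m + 2)) (hnadj : ¬ G.adj (w 0) (w (m + 2)))
    (hdir : ∀ l, 1 ≤ l → l ≤ m → G.dirEdge (w l) (w (m + 2)))
    (hne : ∀ l, 1 ≤ l → l ≤ m → w l ≠ w 0)
    (hcolG : ∀ l, l + 2 ≤ m + 1 → G.isCollider (w l) (w (l + 1)) (w (l + 2)))
    (hcolH : ∀ l, l + 2 ≤ m + 1 → H.isCollider (w l) (w (l + 1)) (w (l + 2)))
    (hlast : G.isCollider (w m) (w (m + 1)) (w (m + 2))) :
    (∀ l, 1 ≤ l → l ≤ m → H.dirEdge (w l) (w (m + 2))) ∧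
      H.isCollider (w m) (w (m + 1)) (w (m + 2)) := by
  set C := G.separator (w 0) (w (m + 2)) with hC
  have h0C : w 0 ∉ C := notMem_separator_left
  have hcC : w (m + 2) ∉ C := notMem_separator_right
  have hsepG : ∀ q, ¬ G.Joins C (G.ancSet C) (w 0) (w (m + 2)) q := fun q hj =>
    hGN.not_mConnected_separator hG h0 hnadj (hj.mConnected hG hcC)
  have hsepH : ∀ q, ¬ H.Joins C (H.ancSet C) (w 0) (w (m + 2)) q := fun q hj =>
    hGN.not_mConnected_separator hG h0 hnadj
      ((markovEquiv_iff.1 h _ _ _ h0).2 (hj.mConnected hH hcC))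
  have hmem : ∀ l, 1 ≤ l → l ≤ m → w l ∈ C := fun l hl hlm =>
    ⟨.inr (.single ⟨_, hdir l hl hlm⟩), hne l hl hlm, hG.ne (hdir l hl hlm)⟩
  have hpred : ∀ {K : MixedGraph V}, (∀ l, l + 2 ≤ m + 1 →
      K.isCollider (w l) (w (l + 1)) (w (l + 2))) → 1 ≤ m →
      K.isCollider (w (m - 1)) (w m) (w (m + 1)) := fun hK hm => by
    have := hK (m - 1) (by omega)
    rwa [show m - 1 + 1 = m by omega, show m - 1 + 2 = m + 1 by omega] at this
  have hb : w (m + 1) ∉ C := fun hbC => by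
    obtain ⟨p, q, h₁, h₂⟩ := hlast
    exact hsepG _ ((hG.joins_of_isCollider h0C hmem hcolG h₁ fun hm =>
      hG.edge_arrow_of_isCollider_right (hpred hcolG hm) h₁).step h₂
        (.inl ⟨rfl, rfl, subset_ancSet hbC⟩))
  refine ⟨fun l hl hlm => ?_, ?_⟩
  · obtain ⟨p, q, he⟩ := h.adj hG hH hHN ⟨_, _, hdir l hl hlm⟩
    cases p
    · obtain ⟨p, -, h₁, -⟩ := hcolH (l - 1) (by omega)
      rw [show l - 1 + 1 = l by omega] at h₁
      exact hH.dirEdge_of_tail h₁ he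
    · exact (hsepH _ (hH.joins_of_isCollider h0C (fun i hi hil => hmem i hi (by omega))
        (fun i hi => hcolH i (by omega)) he fun _ => rfl)).elim
  · obtain ⟨p, q, h₁, h₂⟩ := hlast
    obtain ⟨p, q, h₁⟩ := h.adj hG hH hHN ⟨_, _, h₁⟩
    obtain ⟨p', q', h₂⟩ := h.adj hG hH hHN ⟨_, _, h₂⟩
    by_cases hc : some q = some Mark.arrow ∧ some p' = some Mark.arrow
    · simp only [Option.some.injEq] at hc
      obtain ⟨rfl, rfl⟩ := hc
      exact ⟨_, _, h₁, h₂⟩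
    · exact (hsepH _ ((hH.joins_of_isCollider h0C hmem hcolH h₁ fun hm =>
        hH.edge_arrow_of_isCollider_right (hpred hcolH hm) h₁).step h₂
          (passes_of_notMem hb hc))).elim

lemma MarkovEquiv.hasColliderWithOrder_of_colliderOrderLE (hG : G.IsAncestral)
    (hGN : G.NoInducingWalk) (hH : H.IsAncestral) (hHN : H.NoInducingWalk) (h : MarkovEquiv G H)
    (hik : i ≠ k) (hc : G.colliderOrderLE t i j k) : H.hasColliderWithOrder i j k := by
  induction t generalizing i j k with
  | zero =>
    obtain ⟨hc, hnadj⟩ := hc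
    refine ⟨0, ?_, fun hadj => hnadj (h.symm.adj hH hG hGN hadj)⟩
    have := (h.dirEdge_and_isCollider (m := 0)
      (w := fun n => if n = 0 then i else if n = 1 then j else k) hG hGN hH hHN (by simpa)
      (by simpa) (fun l _ _ => by omega) (fun l _ _ => by omega) (fun l _ => by omega)
      (fun l _ => by omega) (by simpa)).2
    simpa using this
  | succ t ih =>
    rcases hc with hc | ⟨hc, m, w, hm, hw, hnadj, hdir, hinj, hcol⟩
    · exact ih hik hc
    have hcolH : ∀ l, l + 2 ≤ m + 1 → H.hasColliderWithOrder (w l) (w (l + 1)) (w (l + 2)) :=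
      fun l hl => ih (fun he => by
        have := hinj _ _ (by omega) (by omega) he
        omega) (hcol l hl)
    have hlast : G.isCollider (w m) (w (m + 1)) (w (m + 2)) := by
      rcases hw with ⟨rfl, rfl, rfl⟩ | ⟨rfl, rfl, rfl⟩
      · exact hc
      · exact hG.isCollider_symm hc
    obtain ⟨hdirH, hlastH⟩ := h.dirEdge_and_isCollider hG hGN hH hHN (fun he => by
        have := hinj _ _ (by omega) (by omega) he
        omega) hnadj hdir (fun l hl hlm he => by
        have := hinj _ _ (by omega) (by omega) he
        omega) (fun l hl => (hcol l hl).isCollider) (fun l hl => (hcolH l hl).isCollider) hlast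
    have hdisc : IsDiscriminating H m w :=
      ⟨hm, fun hadj => hnadj (h.symm.adj hH hG hGN hadj), hdirH, hinj, hcolH⟩
    have hres := hdisc.hasColliderWithOrder hlastH
    rcases hw with ⟨rfl, rfl, rfl⟩ | ⟨rfl, rfl, rfl⟩
    · exact hres
    · exact hres.symm hH

theorem MarkovEquiv.sameOrderedColliders (hG : G.IsAncestral)
    (hGN : G.NoInducingWalk) (hH : H.IsAncestral) (hHN : H.NoInducingWalk)
    (h : MarkovEquiv G H) : SameOrderedColliders G H where
  adj_iff _ _ := ⟨h.adj hG hH hHN, h.symm.adj hH hG hGN⟩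
  collider_iff _ _ _ hik :=
    ⟨fun ⟨_, ht⟩ => h.hasColliderWithOrder_of_colliderOrderLE hG hGN hH hHN hik ht,
      fun ⟨_, ht⟩ => h.symm.hasColliderWithOrder_of_colliderOrderLE hH hHN hG hGN hik ht⟩

/-- Ancestral graphs without inducing walks are Markov equivalent if and only if they have the same
adjacencies and colliders with order. -/
theorem markovEquiv_iff_sameOrderedColliders (hG : G.IsAncestral)
    (hGN : G.NoInducingWalk) (hH : H.IsAncestral) (hHN : H.NoInducingWalk) :
    MarkovEquiv G H ↔ SameOrderedColliders G H :=
  ⟨fun h => h.sameOrderedColliders hG hGN hH hHN, fun h => h.markovEquiv hG hGN hH hHN⟩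

end Necessity

/-! ### Interventional graphs -/

/-- Colliders with order are preserved by maps preserving nonadjacency, colliders with distinct
endpoints, and directed edges leaving colliders. -/
lemma colliderOrderLE.map {U : Type} {A : MixedGraph V} {B : MixedGraph U} {f : V → U}
    (hf : f.Injective) (hadj : ∀ a b, B.adj (f a) (f b) → A.adj a b)
    (hcol : ∀ i j k, i ≠ k → A.isCollider i j k → B.isCollider (f i) (f j) (f k))
    (hdir : ∀ i j k l, A.isCollider i j k → A.dirEdge j l → B.dirEdge (f j) (f l))
    {t : ℕ} {i j k : V} (hik : i ≠ k) (h : A.colliderOrderLE t i j k) :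
    B.colliderOrderLE t (f i) (f j) (f k) := by
  induction t generalizing i j k with
  | zero => exact ⟨hcol _ _ _ hik h.1, fun hadj' => h.2 (hadj _ _ hadj')⟩
  | succ t ih =>
    rcases h with h | ⟨hc, m, w, hm, hw, hnadj, hd, hinj, hP⟩
    · exact .inl (ih hik h)
    refine .inr ⟨hcol _ _ _ hik hc, m, f ∘ w, hm, ?_, fun h => hnadj (hadj _ _ h),
      fun l hl hlm => ?_, fun l l' hl hl' he => hinj l l' hl hl' (hf he), fun l hl => ?_⟩
    · rcases hw with ⟨rfl, rfl, rfl⟩ | ⟨rfl, rfl, rfl⟩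
      · exact .inl ⟨rfl, rfl, rfl⟩
      · exact .inr ⟨rfl, rfl, rfl⟩
    · have := (hP (l - 1) (by omega)).isCollider
      rw [show l - 1 + 1 = l by omega] at this
      exact hdir _ _ _ _ this (hd l hl hlm)
    · refine ih (fun he => ?_) (hP l hl)
      have := hinj _ _ (by omega) (by omega) he
      omega

section Intervention

variable {ι : Type} {targets : ι → Set V}

/-- The variant of the interventional graph in which the edges from intervention nodes to selection
adjacent nodes are undirected. -/
def relaxedInterventionGraph (G : MixedGraph V) (targets : ι → Set V) :
    MixedGraph (V ⊕ InterventionIndex targets) where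
  edge a b m₁ m₂ :=
    match a, b with
    | Sum.inl a, Sum.inl b => G.edge a b m₁ m₂
    | Sum.inr k, Sum.inl b => b ∈ targets k.1 ∧ m₁ = .tail ∧ (m₂ = .tail ↔ G.selectionAdjacent b)
    | Sum.inl a, Sum.inr k => a ∈ targets k.1 ∧ m₂ = .tail ∧ (m₁ = .tail ↔ G.selectionAdjacent a)
    | Sum.inr _, Sum.inr _ => False

variable {a b : V} {x y z : V ⊕ InterventionIndex targets} {k l : InterventionIndex targets}
  {m n : Mark}

lemma eq_inl_of_edge_arrow (h : (interventionGraph G targets).edge x y m .arrow) :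
    ∃ b, y = .inl b := by
  rcases x with x | x <;> rcases y with y | y
  · exact ⟨y, rfl⟩
  · cases h.2.2
  · exact ⟨y, rfl⟩
  · exact h.elim

lemma eq_inl_of_relaxed_edge_arrow (h : (relaxedInterventionGraph G targets).edge x y m .arrow) :
    ∃ b, y = .inl b := by
  rcases x with x | x <;> rcases y with y | y
  · exact ⟨y, rfl⟩
  · cases h.2.1
  · exact ⟨y, rfl⟩
  · exact h.elim

lemma simple_interventionGraph (hG : G.IsAncestral) : (interventionGraph G targets).Simple := by
  rintro (x | x) (y | y) m₁ m₂ n₁ n₂ h h'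
  · exact hG.simple _ _ _ _ _ _ h h'
  · exact ⟨h.2.1.trans h'.2.1.symm, h.2.2.trans h'.2.2.symm⟩
  · exact ⟨h.2.1.trans h'.2.1.symm, h.2.2.trans h'.2.2.symm⟩
  · exact h.elim

lemma relaxed_dirEdge_inl : (relaxedInterventionGraph G targets).dirEdge (.inl a) x ↔
    ∃ b, x = .inl b ∧ G.dirEdge a b := by
  rcases x with x | x
  · refine ⟨fun h => ⟨x, rfl, h⟩, ?_⟩
    rintro ⟨b, hb, h⟩
    cases hb
    exact h
  · refine ⟨fun h => ?_, by simp⟩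
    cases h.2.1

lemma dirEdge_inl : (interventionGraph G targets).dirEdge (.inl a) x ↔
    ∃ b, x = .inl b ∧ G.dirEdge a b := by
  rcases x with x | x
  · refine ⟨fun h => ⟨x, rfl, h⟩, ?_⟩
    rintro ⟨b, hb, h⟩
    cases hb
    exact h
  · refine ⟨fun h => ?_, by simp⟩
    cases h.2.2

lemma relaxed_transGen_inl (h : TransGen (relaxedInterventionGraph G targets).dirEdge (.inl a) x) :
    ∃ b, x = .inl b ∧ TransGen G.dirEdge a b := by
  induction h with
  | single h =>
    obtain ⟨b, rfl, h⟩ := relaxed_dirEdge_inl.1 h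
    exact ⟨b, rfl, .single h⟩
  | tail _ h ih =>
    obtain ⟨b, rfl, hb⟩ := ih
    obtain ⟨c, rfl, h⟩ := relaxed_dirEdge_inl.1 h
    exact ⟨c, rfl, hb.tail h⟩

lemma relaxed_ancestor_inl : (relaxedInterventionGraph G targets).ancestor (.inl a) x ↔
    ∃ b, x = .inl b ∧ G.ancestor a b := by
  constructor
  · intro h
    rcases reflTransGen_iff_eq_or_transGen.1 h with rfl | h
    · exact ⟨a, rfl, .refl⟩
    · obtain ⟨b, hb, hab⟩ := relaxed_transGen_inl h
      exact ⟨b, hb, hab.to_reflTransGen⟩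
  · rintro ⟨b, rfl, h⟩
    exact h.lift _ fun c d hcd => relaxed_dirEdge_inl.2 ⟨d, rfl, hcd⟩

lemma ancestor_inl : (interventionGraph G targets).ancestor (.inl a) x ↔
    ∃ b, x = .inl b ∧ G.ancestor a b := by
  constructor
  · intro h
    induction h with
    | refl => exact ⟨a, rfl, .refl⟩
    | tail _ h ih =>
      obtain ⟨b, rfl, hb⟩ := ih
      obtain ⟨c, rfl, h⟩ := dirEdge_inl.1 h
      exact ⟨c, rfl, hb.tail h⟩
  · rintro ⟨b, rfl, h⟩
    exact h.lift _ fun c d hcd => dirEdge_inl.2 ⟨d, rfl, hcd⟩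

lemma isLMG_relaxed (hG : G.IsLMG) : (relaxedInterventionGraph G targets).IsLMG := by
  constructor
  · rintro (x | x) (y | y) m₁ m₂ h
    · exact hG.1 _ _ _ _ h
    · exact h
    · exact h
    · exact h
  · rintro (x | x) m₁ m₂ h
    · exact hG.2 _ _ _ h
    · exact h

lemma selectionAdjacent_of_relaxed
    (h : (relaxedInterventionGraph G targets).selectionAdjacent (.inl a)) :
    G.selectionAdjacent a := by
  obtain ⟨b | b, h | h⟩ := h
  · exact ⟨b, .inl h⟩
  · exact ⟨b, .inr h⟩
  · exact h.2.2.1 rfl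
  · exact h.2.2.1 rfl

lemma isAncestral_relaxed (hG : G.IsAncestral) :
    (relaxedInterventionGraph G targets).IsAncestral := by
  refine ⟨isLMG_relaxed hG.1, ?_, ?_, ?_⟩
  · rintro (x | x) h
    · obtain ⟨b, hb, h⟩ := relaxed_transGen_inl h
      cases hb
      exact hG.2.1 _ h
    · obtain ⟨c, hc⟩ := exists_arrow_of_transGen h
      obtain ⟨b, hb⟩ := eq_inl_of_relaxed_edge_arrow hc
      cases hb
  · intro x y h
    obtain ⟨b, rfl⟩ := eq_inl_of_relaxed_edge_arrow h
    obtain ⟨a, rfl⟩ := eq_inl_of_relaxed_edge_arrow ((isLMG_relaxed hG.1).1 _ _ _ _ h)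
    refine ⟨fun h' => ?_, fun h' => ?_⟩
    · obtain ⟨c, hc, h'⟩ := relaxed_transGen_inl h'
      cases hc
      exact (hG.2.2.1 _ _ h).1 h'
    · obtain ⟨c, hc, h'⟩ := relaxed_transGen_inl h'
      cases hc
      exact (hG.2.2.1 _ _ h).2 h'
  · intro x hx y m h
    obtain ⟨b, rfl⟩ := eq_inl_of_relaxed_edge_arrow h
    have hb := selectionAdjacent_of_relaxed hx
    rcases y with y | y
    · exact hG.2.2.2 _ hb _ _ h
    · cases h.2.2.2 hb

lemma relaxed_adj_iff : (relaxedInterventionGraph G targets).adj x y ↔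
    (interventionGraph G targets).adj x y := by
  rcases x with x | x <;> rcases y with y | y
  · exact Iff.rfl
  · constructor
    · rintro ⟨m, n, h⟩
      exact ⟨.arrow, .tail, h.1, rfl, rfl⟩
    · rintro ⟨m, n, h⟩
      by_cases hs : G.selectionAdjacent x
      · exact ⟨.tail, .tail, h.1, rfl, by simp [hs]⟩
      · exact ⟨.arrow, .tail, h.1, rfl, by simp [hs]⟩
  · constructor
    · rintro ⟨m, n, h⟩
      exact ⟨.tail, .arrow, h.1, rfl, rfl⟩
    · rintro ⟨m, n, h⟩
      by_cases hs : G.selectionAdjacent y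
      · exact ⟨.tail, .tail, h.1, rfl, by simp [hs]⟩
      · exact ⟨.tail, .arrow, h.1, rfl, by simp [hs]⟩
  · exact ⟨fun ⟨_, _, h⟩ => h.elim, fun ⟨_, _, h⟩ => h.elim⟩

lemma edge_of_relaxed_edge_arrow
    (h : (relaxedInterventionGraph G targets).edge x y m .arrow) :
    ∃ m', (interventionGraph G targets).edge x y m' .arrow := by
  rcases x with x | x <;> rcases y with y | y
  · exact ⟨m, h⟩
  · cases h.2.1
  · exact ⟨.tail, h.1, rfl, rfl⟩
  · exact h.elim

lemma interventionGraph_symm (hG : G.IsLMG) (h : (interventionGraph G targets).edge x y m n) :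
    (interventionGraph G targets).edge y x n m := by
  rcases x with x | x <;> rcases y with y | y
  · exact hG.1 _ _ _ _ h
  · exact ⟨h.1, h.2.2, h.2.1⟩
  · exact ⟨h.1, h.2.2, h.2.1⟩
  · exact h

lemma isCollider_of_relaxed (hG : G.IsLMG)
    (h : (relaxedInterventionGraph G targets).isCollider x y z) :
    (interventionGraph G targets).isCollider x y z := by
  obtain ⟨m, n, h₁, h₂⟩ := h
  obtain ⟨m, h₁⟩ := edge_of_relaxed_edge_arrow h₁
  obtain ⟨n, h₂⟩ := edge_of_relaxed_edge_arrow ((isLMG_relaxed hG).1 _ _ _ _ h₂)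
  exact ⟨m, n, h₁, interventionGraph_symm hG h₂⟩

lemma not_arrow_of_selectionAdjacent (hG : G.IsAncestral)
    (hd : ∀ i, G.selectionAdjacent i → ¬ doublyIntervenes targets i)
    (hb : G.selectionAdjacent b) (hbk : b ∈ targets k.1) (hkx : .inr k ≠ x) :
    ¬ (interventionGraph G targets).edge x (.inl b) m .arrow := by
  intro h
  rcases x with x | x
  · exact hG.2.2.2 _ hb _ _ h
  · refine hd b hb ⟨k.1, x.1, fun he => hkx ?_, hbk, h.1⟩
    rw [Subtype.ext he]

lemma relaxed_edge_of_isCollider (hG : G.IsAncestral)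
    (hd : ∀ i, G.selectionAdjacent i → ¬ doublyIntervenes targets i) (hxz : x ≠ z)
    (h : (interventionGraph G targets).edge x y m .arrow)
    (h' : (interventionGraph G targets).edge z y n .arrow) :
    ∃ m', (relaxedInterventionGraph G targets).edge x y m' .arrow := by
  rcases x with x | x <;> rcases y with y | y
  · exact ⟨m, h⟩
  · cases h.2.2
  · refine ⟨.tail, h.1, rfl, by simp, fun hs => ?_⟩
    exact (not_arrow_of_selectionAdjacent hG hd hs h.1 hxz h').elim
  · exact h.elim

lemma relaxed_isCollider_iff (hG : G.IsAncestral)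
    (hd : ∀ i, G.selectionAdjacent i → ¬ doublyIntervenes targets i) (hxz : x ≠ z) :
    (relaxedInterventionGraph G targets).isCollider x y z ↔
      (interventionGraph G targets).isCollider x y z := by
  refine ⟨isCollider_of_relaxed hG.1, fun ⟨m, n, h₁, h₂⟩ => ?_⟩
  have h₂ := interventionGraph_symm hG.1 h₂
  obtain ⟨m', h₃⟩ := relaxed_edge_of_isCollider hG hd hxz h₁ h₂
  obtain ⟨n', h₄⟩ := relaxed_edge_of_isCollider hG hd hxz.symm h₂ h₁
  exact ⟨m', n', h₃, (isLMG_relaxed hG.1).1 _ _ _ _ h₄⟩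

lemma relaxed_hasColliderWithOrder_iff (hG : G.IsAncestral)
    (hd : ∀ i, G.selectionAdjacent i → ¬ doublyIntervenes targets i) (hxz : x ≠ z) :
    (relaxedInterventionGraph G targets).hasColliderWithOrder x y z ↔
      (interventionGraph G targets).hasColliderWithOrder x y z := by
  refine exists_congr fun t => ⟨fun h => ?_, fun h => ?_⟩
  · refine h.map (f := id) Function.injective_id (fun _ _ => relaxed_adj_iff.2)
      (fun _ _ _ hik => (relaxed_isCollider_iff hG hd hik).1) ?_ hxz
    rintro i j k l ⟨m, -, h, -⟩ hjl
    obtain ⟨b, rfl⟩ := eq_inl_of_relaxed_edge_arrow h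
    exact dirEdge_inl.2 (relaxed_dirEdge_inl.1 hjl)
  · refine h.map (f := id) Function.injective_id (fun _ _ => relaxed_adj_iff.1)
      (fun _ _ _ hik => (relaxed_isCollider_iff hG hd hik).2) ?_ hxz
    rintro i j k l ⟨m, -, h, -⟩ hjl
    obtain ⟨b, rfl⟩ := eq_inl_of_edge_arrow h
    exact relaxed_dirEdge_inl.2 (dirEdge_inl.1 hjl)

/-- Two graphs agreeing on adjacencies, colliders with distinct endpoints and ancestors of colliders
have the same connecting paths. -/
lemma mConnected.congr_graph {U : Type} {A B : MixedGraph U} (hA : A.Simple) (hB : B.Simple)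
    (hadj : ∀ x y, A.adj x y → B.adj x y)
    (hcol : ∀ x y z, x ≠ z → (A.isCollider x y z ↔ B.isCollider x y z))
    (hanc : ∀ x y z u, A.isCollider x y z → A.ancestor y u → B.ancestor y u) {a b : U} {C : Set U}
    (h : A.mConnected a b C) : B.mConnected a b C := by
  obtain ⟨w, hpath, rfl, rfl, hw⟩ := h
  refine w.mConnected_of_isCollider_iff hA hB hpath (w.mConnecting_iff.1 hw)
    (fun i hi => hadj _ _ ⟨_, _, w.isEdge i hi⟩) (fun i hi0 hi => hcol _ _ _ fun he => ?_)
    fun i hi => ?_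
  · have := hpath _ _ (by omega) (by omega) he
    omega
  · obtain ⟨c, hc, hic⟩ := hw.1 i hi
    exact ⟨c, hc, hanc _ _ _ _ hi.isCollider hic⟩

lemma markovEquiv_relaxed (hG : G.IsAncestral)
    (hd : ∀ i, G.selectionAdjacent i → ¬ doublyIntervenes targets i) :
    MarkovEquiv (interventionGraph G targets) (relaxedInterventionGraph G targets) := by
  refine markovEquiv_iff.2 fun a b C _ => ⟨fun h => ?_, fun h => ?_⟩
  · refine h.congr_graph (simple_interventionGraph hG) (isAncestral_relaxed hG).simple
      (fun _ _ => relaxed_adj_iff.2) (fun _ _ _ hxz => (relaxed_isCollider_iff hG hd hxz).symm) ?_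
    rintro x y z u ⟨m, -, h, -⟩ hyu
    obtain ⟨b, rfl⟩ := eq_inl_of_edge_arrow h
    exact relaxed_ancestor_inl.2 (ancestor_inl.1 hyu)
  · refine h.congr_graph (isAncestral_relaxed hG).simple (simple_interventionGraph hG)
      (fun _ _ => relaxed_adj_iff.1) (fun _ _ _ hxz => relaxed_isCollider_iff hG hd hxz) ?_
    rintro x y z u ⟨m, -, h, -⟩ hyu
    obtain ⟨b, rfl⟩ := eq_inl_of_relaxed_edge_arrow h
    exact ancestor_inl.2 (relaxed_ancestor_inl.1 hyu)

lemma noInducingWalk_relaxed (hG : G.IsAncestral) (hN : G.NoInducingWalk) :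
    (relaxedInterventionGraph G targets).NoInducingWalk := by
  intro x y hxy hnadj hw
  obtain ⟨w, rfl, rfl, hlen, hbi, hanc, -⟩ :=
    hw.exists_bidirected (isAncestral_relaxed hG) hxy hnadj
  have hinl : ∀ i ≤ w.len, ∃ b, w.vtx i = .inl b := fun i hi => by
    rcases Nat.eq_zero_or_pos i with rfl | hi0
    · have := (isLMG_relaxed hG.1).1 _ _ _ _ (w.isEdge 0 (by omega))
      rw [(hbi 0 (by omega)).1] at this
      exact eq_inl_of_relaxed_edge_arrow this
    · have := w.isEdge (i - 1) (by omega)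
      rw [(hbi (i - 1) (by omega)).2, show i - 1 + 1 = i by omega] at this
      exact eq_inl_of_relaxed_edge_arrow this
  have : Nonempty V := ⟨(hinl 0 (by omega)).choose⟩
  choose! f hf using hinl
  refine hN (f 0) (f w.len) (fun he => hxy ?_) (fun ⟨p, q, he⟩ => hnadj ?_)
    ⟨⟨w.len, f, w.mk₁, w.mk₂, fun i hi => ?_⟩, rfl, rfl, fun i hi => ?_⟩
  · rw [hf _ (by omega), hf _ le_rfl, he]
  · rw [hf _ (by omega), hf _ le_rfl]
    exact ⟨p, q, he⟩
  · have := w.isEdge i hi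
    rwa [hf i hi.le, hf _ hi] at this
  · have hi : i + 1 < w.len := hi
    refine ⟨(hbi i (by omega)).2, (hbi _ hi).1, ?_⟩
    have := hanc (i + 1) (by omega) hi
    rw [hf _ hi.le, hf 0 (by omega), hf _ le_rfl, relaxed_ancestor_inl, relaxed_ancestor_inl]
      at this
    refine this.imp ?_ ?_ <;>
    · rintro ⟨b, hb, h⟩
      cases hb
      exact h

lemma IsInducingExtension.relaxed (h : IsInducingExtension G K) :
    IsInducingExtension (relaxedInterventionGraph G targets)
      (relaxedInterventionGraph K targets) where
  subgraph := by
    rintro (x | x) (y | y) m₁ m₂ he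
    · exact h.subgraph _ _ _ _ he
    · simpa only [relaxedInterventionGraph, h.selectionAdjacent_iff] using he
    · simpa only [relaxedInterventionGraph, h.selectionAdjacent_iff] using he
    · exact he.elim
  edge_or := by
    rintro (x | x) (y | y) m₁ m₂ he
    · refine (h.edge_or _ _ _ _ he).imp id ?_
      rintro ⟨rfl, rfl, hne, hnadj, w, rfl, rfl, hw⟩
      refine ⟨rfl, rfl, by simpa using hne, hnadj, ⟨w.len, fun i => .inl (w.vtx i), w.mk₁, w.mk₂,
        fun i hi => w.isEdge i hi⟩, rfl, rfl, fun i hi => ?_⟩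
      obtain ⟨h₁, h₂, h₃⟩ := hw i hi
      refine ⟨h₁, h₂, h₃.imp (fun h₃ => ?_) fun h₃ => ?_⟩ <;>
      exact relaxed_ancestor_inl.2 ⟨_, rfl, h₃⟩
    · left
      simpa only [relaxedInterventionGraph, h.selectionAdjacent_iff] using he
    · left
      simpa only [relaxedInterventionGraph, h.selectionAdjacent_iff] using he
    · exact he.elim

/-- Conditioning on all intervention nodes yields the observed graph. -/
lemma relaxed_mConnected_iff {C : Set V} :
    (relaxedInterventionGraph G targets).mConnected (.inl a) (.inl b)
      (Sum.inl '' C ∪ Set.range Sum.inr) ↔ G.mConnected a b C := by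
  constructor
  · rintro ⟨w, hpath, ha, hb, hw⟩
    have hinl : ∀ i ≤ w.len, ∃ v, w.vtx i = .inl v := fun i hi => by
      rcases hv : w.vtx i with v | v
      · exact ⟨v, rfl⟩
      by_cases hc : w.colliderAt i
      · obtain ⟨c, hc⟩ := eq_inl_of_relaxed_edge_arrow hc.edge_pred
        rw [hv] at hc
        cases hc
      · refine (hw.2 i hi hc ?_).elim
        rw [hv]
        exact .inr ⟨v, rfl⟩
    have : Nonempty V := ⟨a⟩
    choose! f hf using hinl
    rw [hf 0 (by omega), Sum.inl.injEq] at ha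
    rw [hf _ le_rfl, Sum.inl.injEq] at hb
    refine ⟨⟨w.len, f, w.mk₁, w.mk₂, fun i hi => ?_⟩, fun i j hi hj he => ?_, ha, hb,
      fun i hi => ?_, fun i hi hc hiC => ?_⟩
    · have := w.isEdge i hi
      rwa [hf i hi.le, hf _ hi] at this
    · exact hpath i j hi hj (by rw [hf i hi, hf j hj]; exact congrArg Sum.inl he)
    · obtain ⟨c, hc, hic⟩ := hw.1 i hi
      have hlt : i < w.len := hi.2.1
      rw [hf i hlt.le, relaxed_ancestor_inl] at hic
      obtain ⟨c', rfl, hic⟩ := hic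
      refine ⟨c', ?_, hic⟩
      simpa using hc
    · refine hw.2 i hi hc ?_
      rw [hf i hi]
      exact .inl ⟨_, hiC, rfl⟩
  · rintro ⟨w, hpath, rfl, rfl, hw⟩
    refine ⟨⟨w.len, fun i => .inl (w.vtx i), w.mk₁, w.mk₂, fun i hi => w.isEdge i hi⟩,
      fun i j hi hj he => hpath i j hi hj (Sum.inl_injective he), rfl, rfl, fun i hi => ?_,
      fun i hi hc hiC => ?_⟩
    · obtain ⟨c, hc, hic⟩ := hw.1 i hi
      exact ⟨.inl c, .inl ⟨c, hc, rfl⟩, relaxed_ancestor_inl.2 ⟨c, rfl, hic⟩⟩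
    · exact hw.2 i hi hc (by simpa using hiC)

lemma markovEquiv_of_relaxed
    (h : MarkovEquiv (relaxedInterventionGraph G targets) (relaxedInterventionGraph H targets)) :
    MarkovEquiv G H := by
  refine markovEquiv_iff.2 fun a b C hab => ?_
  rw [← relaxed_mConnected_iff (targets := targets),
    ← relaxed_mConnected_iff (targets := targets)]
  exact markovEquiv_iff.1 h _ _ _ (by simpa using hab)

end Intervention

section InterventionCollider

variable {ι : Type} {targets : ι → Set V} {x y z : V ⊕ InterventionIndex targets}

lemma hasColliderWithOrder.inl {i j k : V} (hik : i ≠ k) (h : G.hasColliderWithOrder i j k) :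
    (interventionGraph G targets).hasColliderWithOrder (.inl i) (.inl j) (.inl k) :=
  h.imp fun _ ht => ht.map (B := interventionGraph G targets) Sum.inl_injective
    (fun _ _ h => h) (fun _ _ _ _ h => h) (fun _ _ _ _ _ h => h) hik

lemma interventionGraph_adj_iff (h : ∀ a b, G.adj a b ↔ H.adj a b) :
    (interventionGraph G targets).adj x y ↔ (interventionGraph H targets).adj x y := by
  rcases x with x | x <;> rcases y with y | y
  · exact h x y
  all_goals exact Iff.rfl

/-- Whether a degenerate triple is an interventional collider with order does not depend on the
edges of the observed graph. -/
lemma iColliderWithOrder_self_iff (hG : G.IsLMG) : IColliderWithOrder G targets x y x ↔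
    ∃ k b, x = .inr k ∧ y = .inl b ∧ b ∈ targets k.1 := by
  constructor
  · rintro ⟨⟨t, h⟩, hn⟩
    obtain ⟨m, n, h₁, h₂⟩ := h.isCollider
    obtain ⟨b, rfl⟩ := eq_inl_of_edge_arrow h₁
    rcases x with a | k
    · exact (hn ⟨a, b, a, rfl, rfl, rfl, 0, ⟨m, n, h₁, h₂⟩, fun ⟨_, _, h⟩ => hG.2 _ _ _ h⟩).elim
    · exact ⟨k, b, rfl, rfl, h₁.1⟩
  · rintro ⟨k, b, rfl, rfl, hb⟩
    refine ⟨⟨0, ⟨.tail, .tail, ⟨hb, rfl, rfl⟩, ⟨hb, rfl, rfl⟩⟩, fun ⟨_, _, h⟩ => h⟩, ?_⟩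
    rintro ⟨_, _, _, h, -⟩
    cases h

lemma hasColliderWithOrder_of_iColliderWithOrder (hxz : x ≠ z)
    (hcol : ∀ i j k, i ≠ k → G.hasColliderWithOrder i j k → H.hasColliderWithOrder i j k)
    (hI : IColliderWithOrder G targets x y z → IColliderWithOrder H targets x y z)
    (h : (interventionGraph G targets).hasColliderWithOrder x y z) :
    (interventionGraph H targets).hasColliderWithOrder x y z := by
  by_cases hG : IColliderWithOrder G targets x y z
  · exact (hI hG).1
  · obtain ⟨i, j, k, rfl, rfl, rfl, hc⟩ := not_not.1 fun hn => hG ⟨h, hn⟩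
    have hik : i ≠ k := fun he => hxz (congrArg Sum.inl he)
    exact (hcol i j k hik hc).inl hik

lemma iColliderWithOrder_of_hasColliderWithOrder (hxz : x ≠ z)
    (hcol : ∀ i j k, i ≠ k → H.hasColliderWithOrder i j k → G.hasColliderWithOrder i j k)
    (hI : (interventionGraph G targets).hasColliderWithOrder x y z →
      (interventionGraph H targets).hasColliderWithOrder x y z)
    (h : IColliderWithOrder G targets x y z) : IColliderWithOrder H targets x y z := by
  refine ⟨hI h.1, ?_⟩
  rintro ⟨i, j, k, rfl, rfl, rfl, hc⟩
  exact h.2 ⟨i, j, k, rfl, rfl, rfl, hcol i j k (fun he => hxz (congrArg Sum.inl he)) hc⟩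

lemma sameOrderedColliders_interventionGraph_iff (hG : G.IsLMG) (hH : H.IsLMG)
    (h : SameOrderedColliders G H) :
    SameOrderedColliders (interventionGraph G targets) (interventionGraph H targets) ↔
      ∀ i j k, IColliderWithOrder G targets i j k ↔ IColliderWithOrder H targets i j k := by
  constructor
  · intro hI i j k
    by_cases hik : i = k
    · subst hik
      rw [iColliderWithOrder_self_iff hG, iColliderWithOrder_self_iff hH]
    · exact ⟨iColliderWithOrder_of_hasColliderWithOrder hik
          (fun _ _ _ hne => (h.collider_iff _ _ _ hne).2) (hI.collider_iff _ _ _ hik).1,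
        iColliderWithOrder_of_hasColliderWithOrder hik
          (fun _ _ _ hne => (h.collider_iff _ _ _ hne).1) (hI.collider_iff _ _ _ hik).2⟩
  · refine fun hI => ⟨fun _ _ => interventionGraph_adj_iff h.adj_iff, fun i j k hik => ⟨?_, ?_⟩⟩
    · exact hasColliderWithOrder_of_iColliderWithOrder hik
        (fun _ _ _ hne => (h.collider_iff _ _ _ hne).1) (hI i j k).1
    · exact hasColliderWithOrder_of_iColliderWithOrder hik
        (fun _ _ _ hne => (h.collider_iff _ _ _ hne).2) (hI i j k).2

lemma sameOrderedColliders_relaxed_iff (hG : G.IsAncestral) (hH : H.IsAncestral)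
    (hdG : ∀ i, G.selectionAdjacent i → ¬ doublyIntervenes targets i)
    (hdH : ∀ i, H.selectionAdjacent i → ¬ doublyIntervenes targets i) :
    SameOrderedColliders (relaxedInterventionGraph G targets)
        (relaxedInterventionGraph H targets) ↔
      SameOrderedColliders (interventionGraph G targets) (interventionGraph H targets) := by
  constructor
  · refine fun h => ⟨fun a b => ?_, fun i j k hik => ?_⟩
    · rw [← relaxed_adj_iff, ← relaxed_adj_iff, h.adj_iff]
    · rw [← relaxed_hasColliderWithOrder_iff hG hdG hik,
        ← relaxed_hasColliderWithOrder_iff hH hdH hik, h.collider_iff _ _ _ hik]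
  · refine fun h => ⟨fun a b => ?_, fun i j k hik => ?_⟩
    · rw [relaxed_adj_iff, relaxed_adj_iff, h.adj_iff]
    · rw [relaxed_hasColliderWithOrder_iff hG hdG hik,
        relaxed_hasColliderWithOrder_iff hH hdH hik, h.collider_iff _ _ _ hik]

lemma iMarkovEquiv_iff_relaxed (hG : G.IsAncestral) (hH : H.IsAncestral)
    (hdG : ∀ i, G.selectionAdjacent i → ¬ doublyIntervenes targets i)
    (hdH : ∀ i, H.selectionAdjacent i → ¬ doublyIntervenes targets i) :
    IMarkovEquiv G H targets ↔
      MarkovEquiv (relaxedInterventionGraph G targets) (relaxedInterventionGraph H targets) :=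
  ⟨fun h => (markovEquiv_relaxed hG hdG).symm.trans (h.trans (markovEquiv_relaxed hH hdH)),
    fun h => (markovEquiv_relaxed hG hdG).trans (h.trans (markovEquiv_relaxed hH hdH).symm)⟩

lemma IsMAGExtension.iMarkovEquiv (hG : G.IsAncestral) (h : IsMAGExtension G K)
    (hd : ∀ i, G.selectionAdjacent i → ¬ doublyIntervenes targets i) :
    IMarkovEquiv G K targets := by
  have hext := h.isInducingExtension hG
  exact (iMarkovEquiv_iff_relaxed hG h.2.1 hd fun i hi => hd i (hext.selectionAdjacent_iff.1 hi)).2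
    (hext.relaxed.markovEquiv (isAncestral_relaxed hG) (isAncestral_relaxed h.2.1))

/-- Maximal ancestral graphs are interventionally Markov equivalent if and only if they are Markov
equivalent and have the same interventional colliders with order. -/
theorem iMarkovEquiv_iff (hG : G.IsAncestral) (hGN : G.NoInducingWalk) (hH : H.IsAncestral)
    (hHN : H.NoInducingWalk)
    (hdG : ∀ i, G.selectionAdjacent i → ¬ doublyIntervenes targets i)
    (hdH : ∀ i, H.selectionAdjacent i → ¬ doublyIntervenes targets i) :
    IMarkovEquiv G H targets ↔ MarkovEquiv G H ∧
      ∀ i j k, IColliderWithOrder G targets i j k ↔ IColliderWithOrder H targets i j k := by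
  have hIff : IMarkovEquiv G H targets ↔
      SameOrderedColliders (interventionGraph G targets) (interventionGraph H targets) := by
    rw [iMarkovEquiv_iff_relaxed hG hH hdG hdH, markovEquiv_iff_sameOrderedColliders
      (isAncestral_relaxed hG) (noInducingWalk_relaxed hG hGN) (isAncestral_relaxed hH)
      (noInducingWalk_relaxed hH hHN), sameOrderedColliders_relaxed_iff hG hH hdG hdH]
  have hequiv : IMarkovEquiv G H targets → MarkovEquiv G H := fun h =>
    markovEquiv_of_relaxed ((iMarkovEquiv_iff_relaxed hG hH hdG hdH).1 h)
  rw [← and_iff_right_of_imp hequiv]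
  refine and_congr_right fun h => ?_
  rw [hIff, sameOrderedColliders_interventionGraph_iff hG.1 hH.1
    (h.sameOrderedColliders hG hGN hH hHN)]

end InterventionCollider

end MixedGraph

/-- Theorem: graphical characterization of `𝓘`-Markov equivalence for
ancestral graphs. Let `G`, `H` be ancestral graphs on `[p]` and `𝓘` a multiset of
intervention targets that doubly-intervenes on no selection adjacent node of `G` or `H`.
Then the following are equivalent: (1) `G` and `H` are `𝓘`-Markov equivalent;
(2) `Ḡ` and `H̄` are `𝓘`-Markov equivalent; (3) `Ḡ` and `H̄` are Markov equivalent and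
`Ḡ^𝓘` and `H̄^𝓘` have the same `𝓘`-colliders with order. -/
theorem stmt0 {p : ℕ} {ι : Type} [Fintype ι] (G H : MixedGraph (Fin p))
    (hG : G.IsAncestral) (hH : H.IsAncestral) (targets : ι → Set (Fin p))
    (hdG : ∀ i, G.selectionAdjacent i → ¬ doublyIntervenes targets i)
    (hdH : ∀ i, H.selectionAdjacent i → ¬ doublyIntervenes targets i)
    (Gbar Hbar : MixedGraph (Fin p))
    (hGbar : MixedGraph.IsMAGExtension G Gbar) (hHbar : MixedGraph.IsMAGExtension H Hbar) :
    (IMarkovEquiv G H targets ↔ IMarkovEquiv Gbar Hbar targets) ∧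
    (IMarkovEquiv Gbar Hbar targets ↔
      (MixedGraph.MarkovEquiv Gbar Hbar ∧
        ∀ i j k : Fin p ⊕ InterventionIndex targets,
          IColliderWithOrder Gbar targets i j k ↔ IColliderWithOrder Hbar targets i j k)) := by
  have hextG := hGbar.isInducingExtension hG
  have hextH := hHbar.isInducingExtension hH
  have hequivG := hGbar.iMarkovEquiv hG hdG
  have hequivH := hHbar.iMarkovEquiv hH hdH
  refine ⟨⟨fun h => hequivG.symm.trans (h.trans hequivH),
    fun h => hequivG.trans (h.trans hequivH.symm)⟩, ?_⟩
  exact MixedGraph.iMarkovEquiv_iff hGbar.2.1 (hGbar.2.2.2.noInducingWalk hGbar.2.1)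
    hHbar.2.1 (hHbar.2.2.2.noInducingWalk hHbar.2.1)
    (fun i hi => hdG i (hextG.selectionAdjacent_iff.1 hi))
    (fun i hi => hdH i (hextH.selectionAdjacent_iff.1 hi))
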